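/- Let k be a field, T a tree on d vertices x_1,…,x_d, and let G be the whisker graph of T, i.e., the graph with vertex set {x_1,…,x_d, y_1,…,y_d} and edge set E(T) ∪ {{x_i,y_i} : 1 ≤ i ≤ d} (by Villarreal's classification these are exactly the Cohen-Macaulay trees, of dimension d). Let I(G) ⊆ S = k[x_1,…,x_d,y_1,…,y_d] be its edge ideal. Then for all integers t ≥ 1, depth(S/I(G)^t) = max{d − t + 1, 1}. -/

import Mathlib

open MvPolynomial

/-- The maximal homogeneous ideal of the polynomial ring, generated by all variables. -/
noncomputable def maxHomIdeal (k : Type) [Field k] (V : Type) : Ideal (MvPolynomial V k) :=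
  Ideal.span (Set.range (X : V → MvPolynomial V k))

/-- `depthQuot k I` is the depth of `S/I` where `S = k[x_v : v ∈ V]`, defined as
`min {i : H^i_m(S/I) ≠ 0}` where `m` is the maximal homogeneous ideal and `H^i_m` is
local cohomology. -/
noncomputable def depthQuot (k : Type) [Field k] {V : Type} (I : Ideal (MvPolynomial V k)) : ℕ :=
  sInf {i : ℕ |
    Nontrivial ((localCohomology (maxHomIdeal k V) i).obj
      (ModuleCat.of (MvPolynomial V k) (MvPolynomial V k ⧸ I)))}

/-- The edge ideal of a simple graph `G`, generated by the monomials `x_i x_j` for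
edges `{i, j}` of `G`. -/
noncomputable def edgeIdeal (k : Type) [Field k] {V : Type} (G : SimpleGraph V) :
    Ideal (MvPolynomial V k) :=
  Ideal.span {p | ∃ i j, G.Adj i j ∧ p = X i * X j}

/-- The whisker graph of a graph `T` on `Fin d`: the vertex set is
`{x_1, …, x_d} ⊕ {y_1, …, y_d}` and the edges are those of `T` together with the
whiskers `{x_i, y_i}`. -/
def whiskerGraph {d : ℕ} (T : SimpleGraph (Fin d)) : SimpleGraph (Fin d ⊕ Fin d) :=
  SimpleGraph.fromRel (fun u v =>
    (∃ i j, T.Adj i j ∧ u = Sum.inl i ∧ v = Sum.inl j) ∨ (∃ i, u = Sum.inl i ∧ v = Sum.inr i))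

section

open CategoryTheory Abelian

universe u

/-- `ExtVanishing m n M` says that `Ext^i(R/m, M) = 0` for all `i < n`. -/
def ExtVanishing {R : Type u} [CommRing R] (m : Ideal R) (n : ℕ) (M : Type u)
    [AddCommGroup M] [Module R M] : Prop :=
  ∀ i < n, Subsingleton (Ext (ModuleCat.of R (R ⧸ m)) (ModuleCat.of R M) i)

namespace ExtVanishing

variable {R : Type u} [CommRing R] {m : Ideal R} {n : ℕ} {A B C : Type u}
  [AddCommGroup A] [Module R A] [AddCommGroup B] [Module R B] [AddCommGroup C] [Module R C]

theorem mono {n' : ℕ} (h : ExtVanishing m n A) (hn : n' ≤ n) : ExtVanishing m n' A :=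
  fun i hi => h i (hi.trans_le hn)

theorem zero : ExtVanishing m 0 A := fun _ hi => absurd hi (Nat.not_lt_zero _)

theorem shortExact_of_linearMap (f : A →ₗ[R] B) (g : B →ₗ[R] C) (hf : Function.Injective f)
    (hfg : Function.Exact f g) (hg : Function.Surjective g) :
    (ShortComplex.mk (ModuleCat.ofHom f) (ModuleCat.ofHom g)
      (by ext x; exact hfg.apply_apply_eq_zero x)).ShortExact where
  exact := by
    rw [ShortComplex.moduleCat_exact_iff]
    intro x hx
    exact (hfg x).1 hx
  mono_f := (ModuleCat.mono_iff_injective _).2 hf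
  epi_g := (ModuleCat.epi_iff_surjective _).2 hg

theorem of_equiv (e : A ≃ₗ[R] B) (h : ExtVanishing m n A) : ExtVanishing m n B := by
  intro i hi
  have := h i hi
  have h1 : ∀ x : Ext (ModuleCat.of R (R ⧸ m)) (ModuleCat.of R B) i, x = 0 := by
    intro x
    have h2 : (x.comp (Ext.mk₀ (ModuleCat.ofHom e.symm.toLinearMap)) (add_zero i)).comp
        (Ext.mk₀ (ModuleCat.ofHom e.toLinearMap)) (add_zero i) = x := by
      rw [Ext.comp_assoc_of_third_deg_zero, Ext.mk₀_comp_mk₀, ← ModuleCat.ofHom_comp]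
      simp
    rw [← h2, Subsingleton.elim (x.comp _ _) 0, Ext.zero_comp]
  exact ⟨fun x y => (h1 x).trans (h1 y).symm⟩

theorem mid (f : A →ₗ[R] B) (g : B →ₗ[R] C) (hf : Function.Injective f)
    (hfg : Function.Exact f g) (hg : Function.Surjective g)
    (hA : ExtVanishing m n A) (hC : ExtVanishing m n C) : ExtVanishing m n B := by
  intro i hi
  have := hA i hi
  have := hC i hi
  have hS := shortExact_of_linearMap f g hf hfg hg
  suffices h : ∀ x : Ext (ModuleCat.of R (R ⧸ m)) (ModuleCat.of R B) i, x = 0 from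
    ⟨fun x y => (h x).trans (h y).symm⟩
  intro x
  obtain ⟨y, hy⟩ := Ext.covariant_sequence_exact₂ _ hS x (Subsingleton.elim _ _)
  rw [← hy, Subsingleton.elim y 0, Ext.zero_comp]

theorem left (f : A →ₗ[R] B) (g : B →ₗ[R] C) (hf : Function.Injective f)
    (hfg : Function.Exact f g) (hg : Function.Surjective g)
    (hB : ExtVanishing m (n + 1) B) (hC : ExtVanishing m n C) : ExtVanishing m (n + 1) A := by
  intro i hi
  have := hB i hi
  have hS := shortExact_of_linearMap f g hf hfg hg
  suffices h : ∀ x : Ext (ModuleCat.of R (R ⧸ m)) (ModuleCat.of R A) i, x = 0 from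
    ⟨fun x y => (h x).trans (h y).symm⟩
  intro x
  cases i with
  | zero =>
    have := hS.mono_f
    exact Ext.postcomp_mk₀_injective_of_mono _ (ModuleCat.ofHom f) (Subsingleton.elim _ _)
  | succ i =>
    have := hC i (by omega)
    obtain ⟨y, hy⟩ := Ext.covariant_sequence_exact₁ _ hS x (Subsingleton.elim _ _) rfl
    rw [← hy, Subsingleton.elim y 0, Ext.zero_comp]

theorem right (f : A →ₗ[R] B) (g : B →ₗ[R] C) (hf : Function.Injective f)
    (hfg : Function.Exact f g) (hg : Function.Surjective g)
    (hA : ExtVanishing m (n + 1) A) (hB : ExtVanishing m n B) : ExtVanishing m n C := by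
  intro i hi
  have := hB i hi
  have := hA (i + 1) (by omega)
  have hS := shortExact_of_linearMap f g hf hfg hg
  suffices h : ∀ x : Ext (ModuleCat.of R (R ⧸ m)) (ModuleCat.of R C) i, x = 0 from
    ⟨fun x y => (h x).trans (h y).symm⟩
  intro x
  obtain ⟨y, hy⟩ := Ext.covariant_sequence_exact₃ _ hS x rfl (Subsingleton.elim _ _)
  rw [← hy, Subsingleton.elim y 0, Ext.zero_comp]

theorem of_subsingleton [Subsingleton A] : ExtVanishing m n A := by
  intro i _
  have h0 : (𝟙 (ModuleCat.of R A)) = 0 := by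
    ext x; exact Subsingleton.elim (α := A) _ _
  suffices h : ∀ x : Ext (ModuleCat.of R (R ⧸ m)) (ModuleCat.of R A) i, x = 0 from
    ⟨fun x y => (h x).trans (h y).symm⟩
  intro x
  rw [← Ext.comp_mk₀_id x, h0, Ext.mk₀_zero, Ext.comp_zero]

theorem prod (hA : ExtVanishing m n A) (hB : ExtVanishing m n B) : ExtVanishing m n (A × B) :=
  mid (LinearMap.inl R A B) (LinearMap.snd R A B) LinearMap.inl_injective
    (by intro x; constructor
        · intro h; exact ⟨x.1, by ext <;> simp_all⟩
        · rintro ⟨y, rfl⟩; simp)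
    LinearMap.snd_surjective hA hB

/-- Passing to the quotient by a nonzerodivisor. -/
theorem quotSMulTop {s : R} (hs : IsSMulRegular A s) (h : ExtVanishing m (n + 1) A) :
    ExtVanishing m n (QuotSMulTop s A) :=
  right (LinearMap.lsmul R A s) (Submodule.mkQ _) hs
    (by
      intro x
      rw [Submodule.mkQ_apply, Submodule.Quotient.mk_eq_zero, Submodule.mem_smul_pointwise_iff_exists]
      simp) (Submodule.mkQ_surjective _) h (h.mono (Nat.le_succ n))

theorem of_quotSMulTop {s : R} (hsm : s ∈ m) (hs : IsSMulRegular A s)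
    (h : ExtVanishing m n (QuotSMulTop s A)) : ExtVanishing m (n + 1) A := by
  intro i hi
  have hk : s ∈ Module.annihilator R (ModuleCat.of R (R ⧸ m)) := by
    change s ∈ Module.annihilator R (R ⧸ m)
    rwa [Ideal.annihilator_quotient]
  have zero_g := Ext.postcomp_smul_id_eq_zero_of_mem_annihilator (M := ModuleCat.of R A) hk i
  have mono_g : Mono (AddCommGrpCat.ofHom ((Ext.mk₀ ((ModuleCat.of R A).smulShortComplex s).f).postcomp
      (ModuleCat.of R (R ⧸ m)) (add_zero i))) := by
    cases i with
    | zero =>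
      have := hs.smulShortComplex_shortExact (M := ModuleCat.of R A).mono_f
      rw [AddCommGrpCat.mono_iff_injective]
      exact Ext.postcomp_mk₀_injective_of_mono _ ((ModuleCat.of R A).smulShortComplex s).f
    | succ i =>
      have hx : IsSMulRegular (ModuleCat.of R A) s := hs
      apply (Ext.covariant_sequence_exact₁' _ hx.smulShortComplex_shortExact i (i + 1)
            rfl).mono_g ((AddCommGrpCat.isZero_of_iff_subsingleton.mpr ?_).eq_zero_of_src _)
      exact h i (by omega)
  exact AddCommGrpCat.subsingleton_of_isZero
    (@Limits.IsZero.of_mono_eq_zero _ _ _ _ _ _ mono_g zero_g)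

end ExtVanishing
end

section

open CategoryTheory Limits Opposite

universe u

section
variable {R : Type u} [CommRing R] (K : CochainComplex (ModuleCat.{u} R) ℕ) (n : ℕ)

theorem CochainComplex.exists_homologyπ_eq (x : K.homology n) :
    ∃ z : K.cycles n, K.homologyπ n z = x :=
  (ModuleCat.epi_iff_surjective _).1 (inferInstance : Epi (K.homologyπ n)) x

theorem CochainComplex.iCycles_injective : Function.Injective (K.iCycles n) :=
  (ModuleCat.mono_iff_injective _).1 (inferInstance : Mono (K.iCycles n))

theorem CochainComplex.homologyπ_eq_zero_iff (z : K.cycles n) :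
    K.homologyπ n z = 0 ↔
      ∃ y : K.X ((ComplexShape.up ℕ).prev n), K.d _ n y = K.iCycles n z := by
  have hex : (ShortComplex.mk (K.toCycles ((ComplexShape.up ℕ).prev n) n) (K.homologyπ n)
      (K.toCycles_comp_homologyπ _ _)).Exact :=
    ShortComplex.exact_of_g_is_cokernel _ (K.homologyIsCokernel _ n rfl)
  rw [ShortComplex.moduleCat_exact_iff] at hex
  constructor
  · intro h
    obtain ⟨y, hy⟩ := hex z h
    refine ⟨y, ?_⟩
    change K.toCycles _ n y = z at hy
    rw [← hy, ← ModuleCat.comp_apply, K.toCycles_i]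
  · rintro ⟨y, hy⟩
    have : K.toCycles _ n y = z := by
      apply CochainComplex.iCycles_injective
      rw [← hy, ← ModuleCat.comp_apply, K.toCycles_i]
    rw [← this, ← ModuleCat.comp_apply, K.toCycles_comp_homologyπ]
    rfl

theorem CochainComplex.exists_iCycles_eq (x : K.X n) (hx : K.d n (n + 1) x = 0) :
    ∃ z : K.cycles n, K.iCycles n z = x := by
  have hex : (ShortComplex.mk (K.iCycles n) (K.d n (n + 1)) (K.iCycles_d _ _)).Exact :=
    ShortComplex.exact_of_f_is_kernel _ (K.cyclesIsKernel n (n + 1) (by simp))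
  rw [ShortComplex.moduleCat_exact_iff] at hex
  exact hex x hx

theorem CochainComplex.subsingleton_homology_iff :
    Subsingleton (K.homology n) ↔ ∀ x : K.X n, K.d n (n + 1) x = 0 →
      ∃ y : K.X ((ComplexShape.up ℕ).prev n), K.d _ n y = x := by
  constructor
  · intro h x hx
    obtain ⟨z, rfl⟩ := CochainComplex.exists_iCycles_eq K n x hx
    exact (CochainComplex.homologyπ_eq_zero_iff K n z).1 (Subsingleton.elim _ _)
  · intro h
    suffices h' : ∀ x : K.homology n, x = 0 from ⟨fun x y => (h' x).trans (h' y).symm⟩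
    intro x
    obtain ⟨z, rfl⟩ := CochainComplex.exists_homologyπ_eq K n x
    rw [CochainComplex.homologyπ_eq_zero_iff]
    apply h
    rw [← ModuleCat.comp_apply, K.iCycles_d]
    rfl

theorem CochainComplex.homologyMap_injective {K L : CochainComplex (ModuleCat.{u} R) ℕ}
    (φ : K ⟶ L) (n : ℕ)
    (h : ∀ x : K.X n, K.d n (n + 1) x = 0 →
      (∃ y : L.X ((ComplexShape.up ℕ).prev n), L.d _ n y = φ.f n x) →
      ∃ y : K.X ((ComplexShape.up ℕ).prev n), K.d _ n y = x) :
    Function.Injective (HomologicalComplex.homologyMap φ n) := by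
  rw [injective_iff_map_eq_zero]
  intro x hx
  obtain ⟨z, rfl⟩ := CochainComplex.exists_homologyπ_eq K n x
  rw [CochainComplex.homologyπ_eq_zero_iff]
  apply h
  · rw [← ModuleCat.comp_apply, K.iCycles_d]
    rfl
  · rw [← ModuleCat.comp_apply, HomologicalComplex.homologyπ_naturality, ModuleCat.comp_apply,
      CochainComplex.homologyπ_eq_zero_iff] at hx
    obtain ⟨y, hy⟩ := hx
    refine ⟨y, ?_⟩
    rw [hy, ← ModuleCat.comp_apply, HomologicalComplex.cyclesMap_i, ModuleCat.comp_apply]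
end

section
variable {C : Type*} [Category C] [Abelian C] [HasExt C]

theorem CategoryTheory.ProjectiveResolution.extMk_eq_zero_iff' {X Y : C}
    (P : ProjectiveResolution X) {n : ℕ} (f : P.complex.X n ⟶ Y)
    (hf : P.complex.d (n + 1) n ≫ f = 0) :
    P.extMk f (n + 1) rfl hf = 0 ↔
      ∃ g : P.complex.X ((ComplexShape.up ℕ).prev n) ⟶ Y, P.complex.d n _ ≫ g = f := by
  cases n with
  | succ n =>
    rw [P.extMk_eq_zero_iff f _ rfl hf n rfl]
    have h : (ComplexShape.up ℕ).prev (n + 1) = n := by simp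
    rw [h]
  | zero =>
    have h0 : (ComplexShape.up ℕ).prev 0 = 0 := by simp
    rw [h0]
    have : (∃ g : P.complex.X 0 ⟶ Y, P.complex.d 0 0 ≫ g = f) ↔ f = 0 := by
      constructor
      · rintro ⟨g, rfl⟩
        rw [P.complex.shape _ _ (by simp), zero_comp]
      · rintro rfl
        exact ⟨0, by simp⟩
    rw [this]
    constructor
    · intro h
      rw [← P.extEquivCohomologyClass.apply_eq_iff_eq,
        ProjectiveResolution.extEquivCohomologyClass_extMk,
        ProjectiveResolution.extEquivCohomologyClass_zero,
        CochainComplex.HomComplex.CohomologyClass.mk_eq_zero_iff,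
        CochainComplex.HomComplex.Cocycle.toSingleMk_mem_coboundaries_iff _ _ _ _ _ 1 (by simp)] at h
      obtain ⟨g, hg⟩ := h
      have hz : IsZero (P.cochainComplex.X 1) :=
        P.cochainComplex.isZero_of_isStrictlyLE 0 1 (by simp)
      rw [hz.eq_of_src g 0, comp_zero] at hg
      exact (cancel_epi (P.cochainComplexXIso (-((0:ℕ):ℤ)) 0 rfl).hom).1 (by rw [← hg, comp_zero])
    · rintro rfl
      exact P.extMk_zero _ _
end

section
variable {R : Type u} [CommRing R]

theorem subsingleton_Ext_iff (X Y : ModuleCat.{u} R) (n : ℕ) :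
    Subsingleton (((Ext R (ModuleCat.{u} R) n).obj (op X)).obj Y) ↔
      Subsingleton (Abelian.Ext X Y n) := by
  let P := projectiveResolution X
  rw [(P.isoExt n Y).toLinearEquiv.toEquiv.subsingleton_congr,
    CochainComplex.subsingleton_homology_iff]
  constructor
  · intro h
    suffices h' : ∀ x : Abelian.Ext X Y n, x = 0 from ⟨fun x y => (h' x).trans (h' y).symm⟩
    intro x
    obtain ⟨f, hf, rfl⟩ := P.extMk_surjective x (n + 1) rfl
    rw [P.extMk_eq_zero_iff']
    exact h f hf
  · intro h f hf
    exact (P.extMk_eq_zero_iff' f hf).1 (Subsingleton.elim _ _)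

theorem homologyMap_unop_naturality {ι : Type*} {c : ComplexShape ι}
    {K L : HomologicalComplex (ModuleCat.{u} R)ᵒᵖ c} (Φ : K ⟶ L) (n : ι) :
    HomologicalComplex.homologyMap ((HomologicalComplex.unopFunctor _ _).map Φ.op) n ≫
      (K.homologyUnop n).hom = (L.homologyUnop n).hom ≫ (HomologicalComplex.homologyMap Φ n).unop :=
  (congrArg Quiver.Hom.unop (HomologicalComplex.homologyOp_hom_naturality
    ((HomologicalComplex.unopFunctor _ _).map Φ.op) n)).symm

theorem comp_comp_eq_of_squares {C : Type*} [Category C] {K K' L L' M M' : C} (a' : K' ⟶ L')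
    (i' : L' ⟶ M') (E : M' ⟶ M) (a : K ⟶ L) (i : L ⟶ M) (p : L' ⟶ L) (q : K' ⟶ K)
    (h1 : i' ≫ E = p ≫ i) (h2 : q ≫ a = a' ≫ p) : (a' ≫ i') ≫ E = q ≫ (a ≫ i) := by
  rw [Category.assoc, h1, ← Category.assoc, ← h2, Category.assoc]

theorem homologyMap_Ext_injective {X X' Y : ModuleCat.{u} R} (f : X ⟶ X') (n : ℕ)
    (h : ∀ x : Abelian.Ext X' Y n, (Abelian.Ext.mk₀ f).comp x (zero_add n) = 0 → x = 0) :
    Function.Injective (((Ext R (ModuleCat.{u} R) n).map f.op).app Y) := by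
  let P := projectiveResolution X
  let P' := projectiveResolution X'
  let φ : ProjectiveResolution.Hom P P' f :=
    { hom := ProjectiveResolution.lift f P P'
      hom_f_zero_comp_π_f_zero := by
        rw [← HomologicalComplex.comp_f, ProjectiveResolution.lift_commutes,
          HomologicalComplex.comp_f] }
  let F : ModuleCat.{u} R ⥤ (ModuleCat.{u} R)ᵒᵖ := ((linearYoneda R (ModuleCat.{u} R)).obj Y).rightOp
  let Φ := (F.mapHomologicalComplex (ComplexShape.down ℕ)).map φ.hom
  let Ψ : P'.complex.linearYonedaObj R Y ⟶ P.complex.linearYonedaObj R Y :=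
    ((HomologicalComplex.unopFunctor _ _).map Φ.op)
  have h1 := ProjectiveResolution.isoLeftDerivedObj_hom_naturality f P P' φ.hom
    (by rw [φ.hom_f_zero_comp_π_f_zero]; simp) F n
  have h2 := homologyMap_unop_naturality Φ n
  have key : (P'.isoExt (R := R) n Y).inv ≫ ((Ext R (ModuleCat.{u} R) n).map f.op).app Y =
      HomologicalComplex.homologyMap Ψ n ≫ (P.isoExt (R := R) n Y).inv := by
    have h1' := congrArg Quiver.Hom.unop h1
    exact comp_comp_eq_of_squares _ _ _ _ _ _ _ h1' h2
  have hΨ : Function.Injective (HomologicalComplex.homologyMap Ψ n) := by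
    apply CochainComplex.homologyMap_injective
    intro (x : P'.complex.X n ⟶ Y) hx hy
    have hx' : P'.complex.d (n + 1) n ≫ x = 0 := hx
    have h1 := h (P'.extMk x (n + 1) rfl hx') (by
      rw [P'.mk₀_comp_extMk _ _ _ _ φ, P.extMk_eq_zero_iff']
      exact hy)
    exact (P'.extMk_eq_zero_iff' x hx').1 h1
  have h3 : Function.Injective ((P'.isoExt (R := R) n Y).inv ≫ ((Ext R (ModuleCat.{u} R) n).map f.op).app Y) := by
    rw [key]
    have hinj : Function.Injective (P.isoExt (R := R) n Y).inv :=
      (ModuleCat.mono_iff_injective (P.isoExt (R := R) n Y).inv).1 inferInstance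
    intro a b hab
    exact hΨ (hinj hab)
  intro a b hab
  have hb : Function.Surjective (P'.isoExt (R := R) n Y).inv :=
    (ModuleCat.epi_iff_surjective _).1 inferInstance
  obtain ⟨a, rfl⟩ := hb a
  obtain ⟨b, rfl⟩ := hb b
  exact congrArg _ (h3 hab)

end
end

section

open CategoryTheory Limits Opposite

variable {R : Type} [CommRing R]

theorem localCohomology_isColimit_exists (m : Ideal R) (i : ℕ) (M : ModuleCat R) :
    ∃ c : Cocone ((localCohomology.diagram (localCohomology.idealPowersDiagram m) i) ⋙
      (evaluation _ _).obj M), Nonempty (IsColimit c) ∧ c.pt = (localCohomology m i).obj M := by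
  have := localCohomology.hasColimitDiagram.{0, 0} (localCohomology.idealPowersDiagram m) i
  exact ⟨((evaluation _ _).obj M).mapCocone (colimit.cocone _),
    ⟨isColimitOfPreserves _ (colimit.isColimit _)⟩, rfl⟩

theorem localCohomology_subsingleton (m : Ideal R) (i : ℕ) (M : ModuleCat R)
    (h : ∀ j : ℕ, Subsingleton (Abelian.Ext (ModuleCat.of R (R ⧸ m ^ j)) M i)) :
    Subsingleton ((localCohomology m i).obj M) := by
  obtain ⟨c, ⟨hc⟩, hpt⟩ := localCohomology_isColimit_exists m i M
  rw [← hpt]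
  suffices h' : ∀ x : c.pt, x = 0 from ⟨fun x y => (h' x).trans (h' y).symm⟩
  intro x
  obtain ⟨j, y, rfl⟩ := Concrete.isColimit_exists_rep _ hc x
  have h1 := (subsingleton_Ext_iff _ _ _).2 (h j.unop.unop)
  have h2 : y = 0 := h1.elim y 0
  rw [h2, map_zero]

theorem localCohomology_nontrivial (m : Ideal R) (i : ℕ) (M : ModuleCat R)
    (h1 : Nontrivial (Abelian.Ext (ModuleCat.of R (R ⧸ m ^ 1)) M i))
    (h : ∀ (j : ℕ) (hj : 1 ≤ j) (x : Abelian.Ext (ModuleCat.of R (R ⧸ m ^ 1)) M i),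
      (Abelian.Ext.mk₀ (ModuleCat.ofHom (Submodule.mapQ (m ^ j) (m ^ 1) LinearMap.id
        (Ideal.pow_le_pow_right hj)))).comp x (zero_add i) = 0 → x = 0) :
    Nontrivial ((localCohomology m i).obj M) := by
  obtain ⟨c, ⟨hc⟩, hpt⟩ := localCohomology_isColimit_exists m i M
  rw [← hpt]
  by_contra hcon
  rw [not_nontrivial_iff_subsingleton] at hcon
  have h2 : Nontrivial (((Ext R (ModuleCat R) i).obj (op (ModuleCat.of R (R ⧸ m ^ 1)))).obj M) := by
    rw [← not_subsingleton_iff_nontrivial, subsingleton_Ext_iff, not_subsingleton_iff_nontrivial]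
    exact h1
  obtain ⟨x, hx⟩ := exists_ne (0 : ((Ext R (ModuleCat R) i).obj (op (ModuleCat.of R (R ⧸ m ^ 1)))).obj M)
  obtain ⟨k, f, g, hfg⟩ := Concrete.isColimit_exists_of_rep_eq _ hc (i := op (op 1)) (j := op (op 1)) x 0
    (hcon.elim _ _)
  rw [map_zero] at hfg
  have hk : 1 ≤ k.unop.unop := leOfHom f.unop.unop
  exact hx (homologyMap_Ext_injective _ i (h k.unop.unop hk) (hfg.trans (map_zero _).symm))

namespace ExtVanishing

variable [IsNoetherianRing R] {m : Ideal R} {n : ℕ} {M : Type} [AddCommGroup M] [Module R M]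
  [Module.Finite R M]

theorem subsingleton_ext (hM : m • (⊤ : Submodule R M) < ⊤) (h : ExtVanishing m n M)
    (N : ModuleCat R) [Module.Finite R N]
    (hN : Module.support R N ⊆ PrimeSpectrum.zeroLocus m) (i : ℕ) (hi : i < n) :
    Subsingleton (Abelian.Ext N (ModuleCat.of R M) i) := by
  obtain ⟨rs, hl, hmem, hreg⟩ := ModuleCat.exists_isRegular_of_exists_subsingleton_ext m n
    (ModuleCat.of R M) hM (ModuleCat.of R (R ⧸ m))
    (by change Module.support R (R ⧸ m) = _
        rw [Module.support_eq_zeroLocus, Ideal.annihilator_quotient]) h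
  exact ModuleCat.subsingleton_ext_of_exists_isRegular m N hN (ModuleCat.of R M) hM rs hmem hreg i
    (by omega)

theorem precomp_injective (hM : m • (⊤ : Submodule R M) < ⊤) (h : ExtVanishing m n M)
    {X X' : Type} [AddCommGroup X] [Module R X] [AddCommGroup X'] [Module R X']
    [Module.Finite R X] (f : X →ₗ[R] X') (hf : Function.Surjective f)
    (hX : Module.support R X ⊆ PrimeSpectrum.zeroLocus m)
    (x : Abelian.Ext (ModuleCat.of R X') (ModuleCat.of R M) n)
    (hx : (Abelian.Ext.mk₀ (ModuleCat.ofHom f)).comp x (zero_add n) = 0) : x = 0 := by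
  cases n with
  | zero =>
    have : Epi (ModuleCat.ofHom f) := (ModuleCat.epi_iff_surjective _).2 hf
    apply Abelian.Ext.precomp_mk₀_injective_of_epi (ModuleCat.of R M) (ModuleCat.ofHom f)
    exact hx.trans (map_zero _).symm
  | succ n =>
    have hS := shortExact_of_linearMap (LinearMap.ker f).subtype f
      (Submodule.subtype_injective _) (LinearMap.exact_subtype_ker_map f) hf
    obtain ⟨y, hy⟩ := Abelian.Ext.contravariant_sequence_exact₃ hS (ModuleCat.of R M) x hx
      (add_comm 1 n)
    have := h.subsingleton_ext hM (ModuleCat.of R (LinearMap.ker f))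
      ((Module.support_subset_of_injective _ (Submodule.subtype_injective _)).trans hX) n
      (Nat.lt_succ_self n)
    rw [← hy, Subsingleton.elim y 0, Abelian.Ext.comp_zero]

omit [IsNoetherianRing R] in
theorem support_quotient_pow_subset (m : Ideal R) (j : ℕ) :
    Module.support R (R ⧸ m ^ j) ⊆ PrimeSpectrum.zeroLocus m := by
  rw [Module.support_eq_zeroLocus, Ideal.annihilator_quotient]
  intro p hp x hx
  exact p.2.mem_of_pow_mem j (hp (Ideal.pow_mem_pow hx j))

theorem sInf_localCohomology_eq (hM : m • (⊤ : Submodule R M) < ⊤) (h : ExtVanishing m n M)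
    (h' : ¬ ExtVanishing m (n + 1) M) :
    sInf {i : ℕ | Nontrivial ((localCohomology m i).obj (ModuleCat.of R M))} = n := by
  have hn : Nontrivial ((localCohomology m n).obj (ModuleCat.of R M)) := by
    apply localCohomology_nontrivial
    · rw [← not_subsingleton_iff_nontrivial]
      intro hs
      apply h'
      intro i hi
      rcases Nat.lt_succ_iff_lt_or_eq.1 hi with hi | rfl
      · exact h i hi
      · rwa [pow_one] at hs
    · intro j hj x hx
      refine h.precomp_injective hM _ ?_ (support_quotient_pow_subset m j) x hx
      rintro ⟨y⟩
      exact ⟨Submodule.Quotient.mk y, rfl⟩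
  refine le_antisymm (Nat.sInf_le hn) ?_
  refine le_csInf ⟨n, hn⟩ fun i hi => ?_
  by_contra hlt
  push Not at hlt
  have := localCohomology_subsingleton m i (ModuleCat.of R M) fun j =>
    h.subsingleton_ext hM _ (support_quotient_pow_subset m j) i hlt
  exact not_nontrivial_iff_subsingleton.2 this hi

end ExtVanishing
end

section

open CategoryTheory
open scoped Pointwise

namespace ExtVanishing
universe u
variable {R : Type u} [CommRing R] {m : Ideal R} {n : ℕ} {M : Type u} [AddCommGroup M] [Module R M]

theorem one_iff : ExtVanishing m 1 M ↔ ∀ x : M, (∀ s ∈ m, s • x = 0) → x = 0 := by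
  have e : Abelian.Ext (ModuleCat.of R (R ⧸ m)) (ModuleCat.of R M) 0 ≃ ((R ⧸ m) →ₗ[R] M) :=
    (Abelian.Ext.addEquiv₀.trans ModuleCat.homAddEquiv).toEquiv
  have h0 : ExtVanishing m 1 M ↔ Subsingleton ((R ⧸ m) →ₗ[R] M) := by
    rw [← e.subsingleton_congr]
    exact ⟨fun h => h 0 Nat.one_pos, fun h i hi => by
      obtain rfl : i = 0 := by omega
      exact h⟩
  rw [h0]
  constructor
  · intro h x hx
    have hle : m ≤ LinearMap.ker (LinearMap.toSpanSingleton R M x) :=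
      fun s hs => by simpa using hx s hs
    have h1 : Submodule.liftQ m (LinearMap.toSpanSingleton R M x) hle
        (Submodule.Quotient.mk 1) = x := (Submodule.liftQ_apply ..).trans (by simp)
    rw [← h1, Subsingleton.elim (Submodule.liftQ m _ hle) 0, LinearMap.zero_apply]
  · intro h
    refine ⟨fun f g => ?_⟩
    rw [← sub_eq_zero]
    apply LinearMap.ext
    intro y
    apply h
    intro s hs
    rw [← map_smul]
    obtain ⟨r, rfl⟩ := Submodule.Quotient.mk_surjective _ y
    have hsr : s • r ∈ m := m.mul_mem_right _ hs
    rw [← Submodule.Quotient.mk_smul, (Submodule.Quotient.mk_eq_zero m).2 hsr, map_zero]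

/-- The additive map induced on `A / sA → B / tB` by a map that turns `s` into `t`. -/
def quotSMulTopMap {A B : Type u} [AddCommGroup A] [Module R A] [AddCommGroup B] [Module R B]
    (s t : R) (θ : A →+ B) (h : ∀ z, θ (s • z) = t • θ z) : QuotSMulTop s A →+ QuotSMulTop t B :=
  QuotientAddGroup.map (s • (⊤ : Submodule R A)).toAddSubgroup
    (t • (⊤ : Submodule R B)).toAddSubgroup θ (by
      rintro x ⟨y, -, rfl⟩
      exact ⟨θ y, trivial, (h y).symm⟩)

theorem quotSMulTopMap_mk {A B : Type u} [AddCommGroup A] [Module R A] [AddCommGroup B]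
    [Module R B] (s t : R) (θ : A →+ B) (h : ∀ z, θ (s • z) = t • θ z) (z : A) :
    quotSMulTopMap s t θ h (Submodule.Quotient.mk z) = Submodule.Quotient.mk (θ z) := rfl

variable [IsNoetherianRing R]

theorem exists_isSMulRegular_map [Module.Finite R M] (h : ExtVanishing m 1 M) (ψ : R →+* R)
    (hψ : ∀ p : Ideal R, p.IsPrime → (∀ s ∈ m, ψ s ∈ p) → m ≤ p) :
    ∃ s ∈ m, IsSMulRegular M (ψ s) := by
  by_contra! hcon
  have hfin := associatedPrimes.finite R M
  have hsub : (m : Set R) ⊆ ⋃ p ∈ (hfin.toFinset : Set (Ideal R)), (p.comap ψ : Set R) := by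
    intro s hs
    have h1 : ψ s ∈ ⋃ p ∈ associatedPrimes R M, (p : Set R) := by
      rw [biUnion_associatedPrimes_eq_compl_regular]
      exact hcon s hs
    simpa using h1
  rw [Ideal.subset_union_prime (⊥ : Ideal R) ⊥ (fun p hp _ _ => by
    have : p.IsPrime := IsAssociatedPrime.isPrime (by simpa using hp : p ∈ associatedPrimes R M)
    exact Ideal.IsPrime.comap ψ)] at hsub
  obtain ⟨p, hp, hle⟩ := hsub
  have hp' : p ∈ associatedPrimes R M := by simpa using hp
  obtain ⟨hprime, x, hx⟩ := isAssociatedPrime_iff.1 hp'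
  have hmp := hψ p hprime hle
  have hx0 : x = 0 := one_iff.1 h x fun s hs => by
    have h2 := hmp hs
    rw [hx] at h2
    simpa using h2
  apply hprime.ne_top
  rw [hx, hx0]
  ext; simp

theorem of_retract (ψ : R →+* R)
    (hψ : ∀ p : Ideal R, p.IsPrime → (∀ s ∈ m, ψ s ∈ p) → m ≤ p) (n : ℕ) :
    ∀ (N N' : Type u) [AddCommGroup N] [Module R N] [AddCommGroup N'] [Module R N']
      [Module.Finite R N] (θ : N' →+ N) (ρ : N →+ N'), (∀ z, ρ (θ z) = z) →
      (∀ s z, θ (s • z) = ψ s • θ z) → (∀ s z, ρ (ψ s • z) = s • ρ z) →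
      ExtVanishing m n N → ExtVanishing m n N' := by
  induction n with
  | zero => exact fun _ _ _ _ _ _ _ _ _ _ _ _ _ => zero
  | succ n ih =>
    intro N N' _ _ _ _ _ θ ρ hρθ hθ hρ h
    obtain ⟨s, hs, hreg⟩ := (h.mono (Nat.le_add_left 1 n)).exists_isSMulRegular_map ψ hψ
    have hreg' : IsSMulRegular N' s := by
      intro x y hxy
      have h1 : ψ s • θ x = ψ s • θ y := by
        rw [← hθ, ← hθ]
        exact congrArg θ hxy
      rw [← hρθ x, hreg h1, hρθ]
    refine of_quotSMulTop hs hreg' ?_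
    refine ih (QuotSMulTop (ψ s) N) (QuotSMulTop s N')
      (quotSMulTopMap s (ψ s) θ (hθ s)) (quotSMulTopMap (ψ s) s ρ (hρ s)) ?_ ?_ ?_
      (h.quotSMulTop hreg)
    · intro z
      obtain ⟨z, rfl⟩ := Submodule.Quotient.mk_surjective _ z
      rw [quotSMulTopMap_mk, quotSMulTopMap_mk, hρθ]
    · intro t z
      obtain ⟨z, rfl⟩ := Submodule.Quotient.mk_surjective _ z
      rw [← Submodule.Quotient.mk_smul, quotSMulTopMap_mk, quotSMulTopMap_mk, hθ,
        Submodule.Quotient.mk_smul]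
    · intro t z
      obtain ⟨z, rfl⟩ := Submodule.Quotient.mk_surjective _ z
      rw [← Submodule.Quotient.mk_smul, quotSMulTopMap_mk, quotSMulTopMap_mk, hρ,
        Submodule.Quotient.mk_smul]

end ExtVanishing
end

section

open scoped Pointwise
variable {k : Type} [Field k] {σ : Type}

/-- The monomial ideal generated by the monomials whose exponents lie in `P`. -/
noncomputable def monIdeal (k : Type) [Field k] {σ : Type} (P : Set (σ →₀ ℕ)) :
    Ideal (MvPolynomial σ k) :=
  Ideal.span ((fun u => monomial u (1 : k)) '' P)

theorem mem_monIdeal {P : Set (σ →₀ ℕ)} (hP : IsUpperSet P) {f : MvPolynomial σ k} :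
    f ∈ monIdeal k P ↔ ∀ u ∈ f.support, u ∈ P := by
  rw [monIdeal, mem_ideal_span_monomial_image]
  exact forall₂_congr fun u _ =>
    ⟨fun ⟨w, hw, hle⟩ => hP hle hw, fun h => ⟨u, h, le_rfl⟩⟩

theorem monomial_mem_monIdeal {P : Set (σ →₀ ℕ)} {u : σ →₀ ℕ} (hu : u ∈ P) (c : k) :
    monomial u c ∈ monIdeal k P := by
  have h := (monIdeal k P).mul_mem_left (C c) (Ideal.subset_span ⟨u, hu, rfl⟩)
  simpa [C_mul_monomial] using h

theorem map_mem_of_mem_monIdeal {P : Set (σ →₀ ℕ)} (hP : IsUpperSet P)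
    (θ : MvPolynomial σ k →+ MvPolynomial σ k) {I : Ideal (MvPolynomial σ k)}
    (h : ∀ u ∈ P, ∀ c, θ (monomial u c) ∈ I) {f : MvPolynomial σ k} (hf : f ∈ monIdeal k P) :
    θ f ∈ I := by
  rw [← support_sum_monomial_coeff f, map_sum]
  exact I.sum_mem fun u hu => h u ((mem_monIdeal hP).1 hf u hu) _

theorem monIdeal_union (P Q : Set (σ →₀ ℕ)) :
    monIdeal k (P ∪ Q) = monIdeal k P ⊔ monIdeal k Q := by
  rw [monIdeal, Set.image_union, Ideal.span_union]; rfl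

theorem monIdeal_inter {P Q : Set (σ →₀ ℕ)} (hP : IsUpperSet P) (hQ : IsUpperSet Q) :
    monIdeal k (P ∩ Q) = monIdeal k P ⊓ monIdeal k Q := by
  ext f
  rw [Submodule.mem_inf, mem_monIdeal hP, mem_monIdeal hQ, mem_monIdeal (hP.inter hQ)]
  exact ⟨fun h => ⟨fun u hu => (h u hu).1, fun u hu => (h u hu).2⟩,
    fun h u hu => ⟨h.1 u hu, h.2 u hu⟩⟩

theorem isUpperSet_colon {P : Set (σ →₀ ℕ)} (hP : IsUpperSet P) (a : σ →₀ ℕ) :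
    IsUpperSet {u | u + a ∈ P} :=
  fun _ _ h hu => hP (add_le_add_left h a) hu

theorem monomial_mul_mem_monIdeal {P : Set (σ →₀ ℕ)} (hP : IsUpperSet P) (a : σ →₀ ℕ)
    (g : MvPolynomial σ k) :
    monomial a 1 * g ∈ monIdeal k P ↔ g ∈ monIdeal k {u | u + a ∈ P} := by
  rw [mem_monIdeal hP, mem_monIdeal (isUpperSet_colon hP a)]
  constructor
  · intro h u hu
    refine h (u + a) ?_
    rw [mem_support_iff, add_comm, coeff_monomial_mul]
    simpa using hu
  · intro h u hu
    rw [mem_support_iff, coeff_monomial_mul'] at hu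
    split_ifs at hu with hle
    · have := h (u - a) (by simpa using hu)
      simpa [tsub_add_cancel_of_le hle] using this
    · exact absurd rfl hu

theorem monIdeal_union_Ici (P : Set (σ →₀ ℕ)) (a : σ →₀ ℕ) :
    monIdeal k (P ∪ Set.Ici a) = monIdeal k P ⊔ Ideal.span {monomial a 1} := by
  rw [monIdeal_union]
  congr 1
  apply le_antisymm
  · refine Ideal.span_le.2 ?_
    rintro _ ⟨u, hu, rfl⟩
    refine Ideal.mem_span_singleton'.2 ⟨monomial (u - a) 1, ?_⟩
    rw [monomial_mul, tsub_add_cancel_of_le hu, one_mul]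
  · rw [Ideal.span_singleton_le_iff_mem]
    exact monomial_mem_monIdeal Set.self_mem_Ici 1

variable {n : ℕ}

/-- `DepthGE k n P` says that the quotient of the polynomial ring by the monomial ideal attached to
`P` has vanishing `Ext^i(k, -)` for `i < n`. -/
def DepthGE (k : Type) [Field k] {σ : Type} (n : ℕ) (P : Set (σ →₀ ℕ)) : Prop :=
  ExtVanishing (maxHomIdeal k σ) n (MvPolynomial σ k ⧸ monIdeal k P)

section Sequences

variable {R : Type} [CommRing R] {m : Ideal R}

/-- Multiplication by `f` as a map `R / J' → R / J`. -/
def mulQuot (J J' : Ideal R) (f : R) (h : ∀ g, f * g ∈ J ↔ g ∈ J') : (R ⧸ J') →ₗ[R] (R ⧸ J) :=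
  Submodule.mapQ J' J (LinearMap.mulLeft R f) fun g hg => (h g).2 hg

/-- The projection `R / J → R / J₁` for `J ≤ J₁`. -/
def projQuot {J J₁ : Ideal R} (h : J ≤ J₁) : (R ⧸ J) →ₗ[R] (R ⧸ J₁) :=
  Submodule.mapQ J J₁ LinearMap.id h

theorem projQuot_surjective {J J₁ : Ideal R} (h : J ≤ J₁) : Function.Surjective (projQuot h) := by
  intro x
  obtain ⟨x, rfl⟩ := Submodule.Quotient.mk_surjective _ x
  exact ⟨Submodule.Quotient.mk x, rfl⟩

theorem mulQuot_injective (J J' : Ideal R) (f : R) (h : ∀ g, f * g ∈ J ↔ g ∈ J') :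
    Function.Injective (mulQuot J J' f h) := by
  rw [injective_iff_map_eq_zero]
  intro x hx
  obtain ⟨x, rfl⟩ := Submodule.Quotient.mk_surjective _ x
  rw [Submodule.Quotient.mk_eq_zero]
  exact (h x).1 ((Submodule.Quotient.mk_eq_zero J).1 hx)

theorem mulQuot_exact (J J' : Ideal R) (f : R) (h : ∀ g, f * g ∈ J ↔ g ∈ J') :
    Function.Exact (mulQuot J J' f h)
      (projQuot (le_sup_left : J ≤ J ⊔ Ideal.span {f})) := by
  intro x
  obtain ⟨x, rfl⟩ := Submodule.Quotient.mk_surjective _ x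
  constructor
  · intro hx
    have hx : x ∈ J ⊔ Ideal.span {f} := (Submodule.Quotient.mk_eq_zero _).1 hx
    obtain ⟨a, ha, b, hb, rfl⟩ := Submodule.mem_sup.1 hx
    obtain ⟨c, rfl⟩ := Ideal.mem_span_singleton'.1 hb
    refine ⟨Submodule.Quotient.mk c, (Submodule.Quotient.eq J).2 ?_⟩
    have : f * c - (a + c * f) = -a := by ring
    change f * c - (a + c * f) ∈ J
    rw [this]
    exact J.neg_mem ha
  · rintro ⟨y, hy⟩
    obtain ⟨y, rfl⟩ := Submodule.Quotient.mk_surjective _ y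
    rw [← hy]
    refine (Submodule.Quotient.mk_eq_zero (J ⊔ Ideal.span {f})).2 ?_
    exact Ideal.mem_sup_right (Ideal.mem_span_singleton'.2 ⟨y, mul_comm _ _⟩)

theorem ExtVanishing.quotient_sup {J₁ J₂ : Ideal R}
    (h : ExtVanishing m (n + 1) (R ⧸ (J₁ ⊓ J₂))) (h₁ : ExtVanishing m n (R ⧸ J₁))
    (h₂ : ExtVanishing m n (R ⧸ J₂)) : ExtVanishing m n (R ⧸ (J₁ ⊔ J₂)) := by
  let f : (R ⧸ (J₁ ⊓ J₂)) →ₗ[R] (R ⧸ J₁) × (R ⧸ J₂) :=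
    (projQuot inf_le_left).prod (projQuot inf_le_right)
  let g : (R ⧸ J₁) × (R ⧸ J₂) →ₗ[R] (R ⧸ (J₁ ⊔ J₂)) :=
    (projQuot le_sup_left).coprod (-projQuot le_sup_right)
  refine ExtVanishing.right f g ?_ ?_ ?_ h (h₁.prod h₂)
  · rw [injective_iff_map_eq_zero]
    intro x hx
    obtain ⟨x, rfl⟩ := Submodule.Quotient.mk_surjective _ x
    have h1 := congrArg Prod.fst hx
    have h2 := congrArg Prod.snd hx
    exact (Submodule.Quotient.mk_eq_zero _).2
      ⟨(Submodule.Quotient.mk_eq_zero J₁).1 h1, (Submodule.Quotient.mk_eq_zero J₂).1 h2⟩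
  · rintro ⟨x, y⟩
    obtain ⟨x, rfl⟩ := Submodule.Quotient.mk_surjective _ x
    obtain ⟨y, rfl⟩ := Submodule.Quotient.mk_surjective _ y
    have hg : g (Submodule.Quotient.mk x, Submodule.Quotient.mk y) =
        Submodule.Quotient.mk (x - y) := by
      rw [sub_eq_add_neg]; rfl
    rw [hg, Submodule.Quotient.mk_eq_zero]
    constructor
    · intro hx
      obtain ⟨a, ha, b, hb, hab⟩ := Submodule.mem_sup.1 hx
      refine ⟨Submodule.Quotient.mk (x - a), Prod.ext ?_ ?_⟩
      · refine (Submodule.Quotient.eq J₁).2 ?_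
        change x - a - x ∈ J₁
        rw [show x - a - x = -a by ring]
        exact J₁.neg_mem ha
      · refine (Submodule.Quotient.eq J₂).2 ?_
        change x - a - y ∈ J₂
        rw [show x - a - y = b by linear_combination -hab]
        exact hb
    · rintro ⟨z, hz⟩
      obtain ⟨z, rfl⟩ := Submodule.Quotient.mk_surjective _ z
      have h1 : z - x ∈ J₁ := (Submodule.Quotient.eq J₁).1 (congrArg Prod.fst hz)
      have h2 : z - y ∈ J₂ := (Submodule.Quotient.eq J₂).1 (congrArg Prod.snd hz)
      exact Submodule.mem_sup.2 ⟨-(z - x), J₁.neg_mem h1, z - y, h2, by ring⟩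
  · intro x
    obtain ⟨y, rfl⟩ := projQuot_surjective (le_sup_left : J₁ ≤ J₁ ⊔ J₂) x
    exact ⟨(y, 0), by simp [g]⟩

end Sequences

namespace DepthGE

theorem mono {n' : ℕ} {P : Set (σ →₀ ℕ)} (h : DepthGE k n P) (hn : n' ≤ n) : DepthGE k n' P :=
  ExtVanishing.mono h hn

theorem zero {P : Set (σ →₀ ℕ)} : DepthGE k 0 P := ExtVanishing.zero

theorem univ : DepthGE k n (Set.univ : Set (σ →₀ ℕ)) := by
  have : monIdeal k (Set.univ : Set (σ →₀ ℕ)) = ⊤ := by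
    rw [Ideal.eq_top_iff_one]
    exact monomial_mem_monIdeal (Set.mem_univ 0) 1
  have : Subsingleton (MvPolynomial σ k ⧸ monIdeal k (Set.univ : Set (σ →₀ ℕ))) := by
    rwa [Ideal.Quotient.subsingleton_iff]
  exact ExtVanishing.of_subsingleton

theorem of_colon_of_union {P : Set (σ →₀ ℕ)} (hP : IsUpperSet P) (a : σ →₀ ℕ)
    (h : DepthGE k n {u | u + a ∈ P}) (h' : DepthGE k n (P ∪ Set.Ici a)) : DepthGE k n P := by
  rw [DepthGE, monIdeal_union_Ici] at h'
  exact ExtVanishing.mid _ _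
    (mulQuot_injective _ _ _ (monomial_mul_mem_monIdeal hP a)) (mulQuot_exact _ _ _ _)
    (projQuot_surjective _) h h'

theorem colon_of_union {P : Set (σ →₀ ℕ)} (hP : IsUpperSet P) (a : σ →₀ ℕ)
    (h : DepthGE k (n + 1) P) (h' : DepthGE k n (P ∪ Set.Ici a)) :
    DepthGE k (n + 1) {u | u + a ∈ P} := by
  rw [DepthGE, monIdeal_union_Ici] at h'
  exact ExtVanishing.left _ _
    (mulQuot_injective _ _ _ (monomial_mul_mem_monIdeal hP a)) (mulQuot_exact _ _ _ _)
    (projQuot_surjective _) h h'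

theorem union_of_colon {P : Set (σ →₀ ℕ)} (hP : IsUpperSet P) (a : σ →₀ ℕ)
    (h : DepthGE k (n + 1) {u | u + a ∈ P}) (h' : DepthGE k n P) :
    DepthGE k n (P ∪ Set.Ici a) := by
  rw [DepthGE, monIdeal_union_Ici]
  exact ExtVanishing.right _ _
    (mulQuot_injective _ _ _ (monomial_mul_mem_monIdeal hP a)) (mulQuot_exact _ _ _ _)
    (projQuot_surjective _) h h'

theorem union {P Q : Set (σ →₀ ℕ)} (hP : IsUpperSet P) (hQ : IsUpperSet Q)
    (h : DepthGE k (n + 1) (P ∩ Q)) (h₁ : DepthGE k n P) (h₂ : DepthGE k n Q) :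
    DepthGE k n (P ∪ Q) := by
  rw [DepthGE, monIdeal_inter hP hQ] at h
  rw [DepthGE, monIdeal_union]
  exact h.quotient_sup h₁ h₂

/-- Killing a variable not occurring in a monomial ideal lowers the depth by at most one. -/
theorem union_single {P : Set (σ →₀ ℕ)} (hP : IsUpperSet P) (v : σ)
    (hv : ∀ u, u + Finsupp.single v 1 ∈ P → u ∈ P) (h : DepthGE k (n + 1) P) :
    DepthGE k n (P ∪ Set.Ici (Finsupp.single v 1)) := by
  refine union_of_colon hP _ ?_ (h.mono n.le_succ)
  have : {u | u + Finsupp.single v 1 ∈ P} = P :=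
    Set.ext fun u => ⟨hv u, fun hu => hP le_self_add hu⟩
  rwa [this]

theorem of_union_single {P : Set (σ →₀ ℕ)} (hP : IsUpperSet P) (v : σ)
    (hv : ∀ u, u + Finsupp.single v 1 ∈ P → u ∈ P)
    (h : DepthGE k n (P ∪ Set.Ici (Finsupp.single v 1))) : DepthGE k (n + 1) P := by
  have hcol : ∀ g, monomial (Finsupp.single v 1) (1 : k) * g ∈ monIdeal k P ↔
      g ∈ monIdeal k P := by
    intro g
    rw [monomial_mul_mem_monIdeal hP]
    have : {u | u + Finsupp.single v 1 ∈ P} = P :=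
      Set.ext fun u => ⟨hv u, fun hu => hP le_self_add hu⟩
    rw [this]
  have hreg : IsSMulRegular (MvPolynomial σ k ⧸ monIdeal k P)
      (monomial (Finsupp.single v 1) (1 : k)) := by
    intro x y hxy
    apply mulQuot_injective _ _ _ hcol
    obtain ⟨x, rfl⟩ := Submodule.Quotient.mk_surjective _ x
    obtain ⟨y, rfl⟩ := Submodule.Quotient.mk_surjective _ y
    exact hxy
  refine ExtVanishing.of_quotSMulTop (s := monomial (Finsupp.single v 1) 1)
    (Ideal.subset_span ⟨v, rfl⟩) hreg ?_
  rw [DepthGE, monIdeal_union_Ici] at h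
  refine ExtVanishing.of_equiv ?_ h
  have hker : LinearMap.ker (projQuot (le_sup_left : monIdeal k P ≤ monIdeal k P ⊔
      Ideal.span {monomial (Finsupp.single v 1) 1})) =
      monomial (Finsupp.single v 1) (1 : k) • (⊤ : Submodule (MvPolynomial σ k) _) := by
    ext x
    rw [LinearMap.mem_ker, (mulQuot_exact _ _ _ hcol) x, Submodule.mem_smul_pointwise_iff_exists]
    constructor
    · rintro ⟨y, rfl⟩
      obtain ⟨y, rfl⟩ := Submodule.Quotient.mk_surjective _ y
      exact ⟨Submodule.Quotient.mk y, trivial, rfl⟩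
    · rintro ⟨y, -, rfl⟩
      obtain ⟨y, rfl⟩ := Submodule.Quotient.mk_surjective _ y
      exact ⟨Submodule.Quotient.mk y, rfl⟩
  exact (((Submodule.quotEquivOfEq _ _ hker).symm).trans
    (LinearMap.quotKerEquivOfSurjective _ (projQuot_surjective _))).symm

end DepthGE
end

section

variable {k : Type} [Field k] {σ : Type} {n : ℕ}

/-- Multiplication of the `v`-th exponent by `a + 1`. -/
noncomputable def scaleExp (v : σ) (a : ℕ) (u : σ →₀ ℕ) : σ →₀ ℕ := u + Finsupp.single v (a * u v)

theorem scaleExp_le_iff (v : σ) (a b : ℕ) (hb : b ≤ a) (s u : σ →₀ ℕ) :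
    scaleExp v a s ≤ scaleExp v a u + Finsupp.single v b ↔ s ≤ u := by
  classical
  constructor
  · intro h w
    have h1 := h w
    simp only [scaleExp, Finsupp.add_apply, Finsupp.single_apply] at h1
    by_cases hw : v = w
    · subst hw
      simp only [if_true] at h1
      by_contra hlt
      have : u v + 1 ≤ s v := by omega
      nlinarith
    · simpa [hw] using h1
  · intro h w
    have h1 := h w
    simp only [scaleExp, Finsupp.add_apply, Finsupp.single_apply]
    by_cases hw : v = w
    · subst hw
      simp only [if_true]
      nlinarith
    · simpa [hw] using h1

theorem scaleExp_add (v : σ) (a : ℕ) (s u : σ →₀ ℕ) :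
    scaleExp v a (s + u) = scaleExp v a s + scaleExp v a u := by
  simp only [scaleExp, Finsupp.add_apply, mul_add, Finsupp.single_add]
  abel

theorem scaleExp_injective (v : σ) (a : ℕ) : Function.Injective (scaleExp v a) := by
  intro s u h
  apply le_antisymm
  · rw [← scaleExp_le_iff v a 0 a.zero_le, h]; simp
  · rw [← scaleExp_le_iff v a 0 a.zero_le, h]; simp

/-- The substitution `x_v ↦ x_v ^ (a + 1)`. -/
noncomputable def scaleHom (k : Type) [Field k] (v : σ) (a : ℕ) :
    MvPolynomial σ k →+* MvPolynomial σ k :=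
  (aeval (fun w => monomial (scaleExp v a (Finsupp.single w 1)) (1 : k))).toRingHom

theorem scaleHom_monomial (v : σ) (a : ℕ) (u : σ →₀ ℕ) (c : k) :
    scaleHom k v a (monomial u c) = monomial (scaleExp v a u) c := by
  induction u using Finsupp.induction_linear generalizing c with
  | zero =>
    have : scaleExp v a 0 = 0 := by simp [scaleExp]
    rw [this]
    simp [scaleHom]
  | add f g hf hg =>
    rw [← mul_one c, ← monomial_mul, map_mul, hf, hg, monomial_mul, scaleExp_add]
  | single w b =>
    have h2 : scaleExp v a (Finsupp.single w b) = b • scaleExp v a (Finsupp.single w 1) := by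
      induction b with
      | zero => simp [scaleExp]
      | succ b ih => rw [Finsupp.single_add, scaleExp_add, ih, add_smul, one_smul]
    have h : monomial (Finsupp.single w b) c = C c * X w ^ b := by
      rw [C_mul_X_pow_eq_monomial]
    rw [h, h2, map_mul, map_pow]
    simp [scaleHom, monomial_pow, C_mul_monomial]

/-- The additive map sending `x^u` to `x^(scaleExp v a u + b e_v)`. -/
noncomputable def scaleShift (k : Type) [Field k] (v : σ) (a b : ℕ) :
    MvPolynomial σ k →+ MvPolynomial σ k where
  toFun f := monomial (Finsupp.single v b) 1 * scaleHom k v a f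
  map_zero' := by rw [map_zero, mul_zero]
  map_add' f g := by rw [map_add, mul_add]

theorem scaleShift_apply (v : σ) (a b : ℕ) (f : MvPolynomial σ k) :
    scaleShift k v a b f = monomial (Finsupp.single v b) 1 * scaleHom k v a f := rfl

/-- The additive map extracting the coefficients at the exponents in the image of
`u ↦ scaleExp v a u + b e_v`. -/
noncomputable def unscale (k : Type) [Field k] (v : σ) (a b : ℕ) :
    MvPolynomial σ k →+ MvPolynomial σ k :=
  AddMonoidAlgebra.comapDomainAddMonoidHom
    (fun u => scaleExp v a u + Finsupp.single v b)
    ((add_left_injective _).comp (scaleExp_injective v a))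

theorem coeff_unscale (v : σ) (a b : ℕ) (f : MvPolynomial σ k) (u : σ →₀ ℕ) :
    coeff u (unscale k v a b f) = coeff (scaleExp v a u + Finsupp.single v b) f := rfl

theorem unscale_scaleHom_mul (v : σ) (a b : ℕ) (hb : b ≤ a) (s z : MvPolynomial σ k) :
    unscale k v a b (scaleHom k v a s * z) = s * unscale k v a b z := by
  induction s using MvPolynomial.induction_on' with
  | add p q hp hq => rw [map_add, add_mul, add_mul, map_add, hp, hq]
  | monomial s c =>
    ext u
    rw [scaleHom_monomial, coeff_unscale, coeff_monomial_mul', coeff_monomial_mul', coeff_unscale]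
    simp only [scaleExp_le_iff v a b hb]
    split_ifs with h
    · congr 2
      conv_lhs => rw [← tsub_add_cancel_of_le h, scaleExp_add, add_right_comm, add_tsub_cancel_right]
    · rfl

/-- The additive map `R / I → R / J` induced by an additive map sending `I` to `J`. -/
def quotAddMap {R : Type} [CommRing R] (I J : Ideal R) (f : R →+ R) (h : ∀ x ∈ I, f x ∈ J) :
    (R ⧸ I) →+ (R ⧸ J) :=
  QuotientAddGroup.map I.toAddSubgroup J.toAddSubgroup f h

theorem quotAddMap_mk {R : Type} [CommRing R] (I J : Ideal R) (f : R →+ R)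
    (h : ∀ x ∈ I, f x ∈ J) (x : R) :
    quotAddMap I J f h (Submodule.Quotient.mk x) = Submodule.Quotient.mk (f x) := rfl

theorem DepthGE.of_scale [Finite σ] {P : Set (σ →₀ ℕ)} (hP : IsUpperSet P) (v : σ) (a b : ℕ)
    (hb : b ≤ a) (h : DepthGE k n P) :
    DepthGE k n {u | scaleExp v a u + Finsupp.single v b ∈ P} := by
  classical
  have hP' : IsUpperSet {u | scaleExp v a u + Finsupp.single v b ∈ P} := by
    intro s u hsu hs
    obtain ⟨w, rfl⟩ := exists_add_of_le hsu
    refine hP ?_ hs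
    rw [scaleExp_add]
    gcongr
    exact le_self_add
  have hθ : ∀ f ∈ monIdeal k {u | scaleExp v a u + Finsupp.single v b ∈ P},
      scaleShift k v a b f ∈ monIdeal k P := by
    intro f hf
    refine map_mem_of_mem_monIdeal hP' (scaleShift k v a b) ?_ hf
    intro u hu c
    rw [scaleShift_apply, scaleHom_monomial, monomial_mul, one_mul]
    exact monomial_mem_monIdeal (by rwa [add_comm]) c
  have hρ : ∀ f ∈ monIdeal k P, unscale k v a b f ∈
      monIdeal k {u | scaleExp v a u + Finsupp.single v b ∈ P} := by
    intro f hf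
    rw [mem_monIdeal hP']
    intro u hu
    rw [mem_support_iff, coeff_unscale] at hu
    exact (mem_monIdeal hP).1 hf _ (mem_support_iff.2 hu)
  refine ExtVanishing.of_retract (scaleHom k v a) ?_ n (MvPolynomial σ k ⧸ monIdeal k P) _
    (quotAddMap _ _ (scaleShift k v a b) hθ)
    (quotAddMap _ _ (unscale k v a b) hρ) ?_ ?_ ?_ h
  · intro p hp hs
    rw [maxHomIdeal, Ideal.span_le]
    rintro _ ⟨w, rfl⟩
    have h1 := hs (X w) (Ideal.subset_span ⟨w, rfl⟩)
    rw [X, scaleHom_monomial] at h1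
    by_cases hw : v = w
    · subst hw
      have : monomial (scaleExp v a (Finsupp.single v 1)) (1 : k) = X v ^ (a + 1) := by
        rw [X_pow_eq_monomial, scaleExp, ← Finsupp.single_add]
        simp [add_comm]
      rw [this] at h1
      exact hp.mem_of_pow_mem _ h1
    · have : scaleExp v a (Finsupp.single w 1) = Finsupp.single w 1 := by
        simp [scaleExp, Ne.symm hw]
      rwa [this] at h1
  · intro z
    obtain ⟨z, rfl⟩ := Submodule.Quotient.mk_surjective _ z
    rw [quotAddMap_mk, quotAddMap_mk]
    refine congrArg Submodule.Quotient.mk ?_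
    rw [scaleShift_apply, mul_comm, unscale_scaleHom_mul v a b hb]
    convert mul_one z
    ext u
    rw [coeff_unscale, coeff_monomial, coeff_one]
    have : Finsupp.single v b = scaleExp v a u + Finsupp.single v b ↔ 0 = u := by
      constructor
      · intro h
        have h1 : scaleExp v a u = scaleExp v a 0 := by
          have := left_eq_add.1 (h.trans (add_comm _ _))
          rw [this]; simp [scaleExp]
        exact (scaleExp_injective v a h1).symm
      · rintro rfl
        simp [scaleExp]
    simp only [this]
  · intro s z
    obtain ⟨z, rfl⟩ := Submodule.Quotient.mk_surjective _ z
    rw [← Submodule.Quotient.mk_smul, quotAddMap_mk, quotAddMap_mk, ← Submodule.Quotient.mk_smul]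
    refine congrArg Submodule.Quotient.mk ?_
    rw [scaleShift_apply, scaleShift_apply, smul_eq_mul, map_mul, smul_eq_mul]
    ring
  · intro s z
    obtain ⟨z, rfl⟩ := Submodule.Quotient.mk_surjective _ z
    rw [← Submodule.Quotient.mk_smul, quotAddMap_mk, quotAddMap_mk, ← Submodule.Quotient.mk_smul]
    exact congrArg Submodule.Quotient.mk (unscale_scaleHom_mul v a b hb s z)

namespace DepthGE

/-- Colon ideals by a variable do not have smaller depth. -/
theorem colon_single [Finite σ] {P : Set (σ →₀ ℕ)} (hP : IsUpperSet P) (v : σ) (a : ℕ)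
    (ha : ∀ u p, u + Finsupp.single v p ∈ P → u + Finsupp.single v a ∈ P) (h : DepthGE k n P) :
    DepthGE k n {u | u + Finsupp.single v 1 ∈ P} := by
  cases n with
  | zero => exact zero
  | succ n =>
    rcases Nat.eq_zero_or_pos a with rfl | ha0
    · have : {u | u + Finsupp.single v 1 ∈ P} = P := by
        ext u
        exact ⟨fun hu => by simpa using ha u 1 hu, fun hu => hP le_self_add hu⟩
      rwa [this]
    have h1 := h.of_scale hP v a a le_rfl
    have h0 := h.of_scale hP v a 0 a.zero_le
    have hup : IsUpperSet {u | scaleExp v a u + Finsupp.single v 0 ∈ P} := by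
      intro s u hsu hs
      obtain ⟨w, rfl⟩ := exists_add_of_le hsu
      refine hP ?_ hs
      rw [scaleExp_add]
      gcongr
      exact le_self_add
    have key : ∀ u p, a ≤ p → (u + Finsupp.single v p ∈ P ↔ u + Finsupp.single v a ∈ P) :=
      fun u p hp => ⟨ha u p, fun hu => hP (by gcongr) hu⟩
    have e1 : {u | u + Finsupp.single v 1 ∈ {u | scaleExp v a u + Finsupp.single v 0 ∈ P}} =
        {u | scaleExp v a u + Finsupp.single v a ∈ P} := by
      ext u
      simp only [Set.mem_ofPred_eq, scaleExp, Finsupp.single_zero, add_zero, Finsupp.add_apply,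
        Finsupp.single_eq_same, add_assoc, ← Finsupp.single_add]
      rw [key _ _ (by nlinarith : a ≤ 1 + a * (u v + 1)), key _ _ (by nlinarith : a ≤ a * u v + a)]
    have e2 : {u | scaleExp v a u + Finsupp.single v 0 ∈ P} ∪ Set.Ici (Finsupp.single v 1) =
        P ∪ Set.Ici (Finsupp.single v 1) := by
      ext u
      simp only [Set.mem_union, Set.mem_ofPred_eq, Set.mem_Ici, Finsupp.single_le_iff,
        Finsupp.single_zero, add_zero]
      by_cases hu : 1 ≤ u v
      · simp [hu]
      · have : u v = 0 := by omega
        simp [scaleExp, this]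
    have h2 : DepthGE k n (P ∪ Set.Ici (Finsupp.single v 1)) := by
      rw [← e2]
      refine union_of_colon hup _ ?_ (h0.mono n.le_succ)
      rw [e1]
      exact h1
    exact colon_of_union hP _ h h2

theorem one_of_socle {P : Set (σ →₀ ℕ)} (hP : IsUpperSet P)
    (h : ∀ u, u ∉ P → ∃ v, u + Finsupp.single v 1 ∉ P) : DepthGE k 1 P := by
  refine ExtVanishing.one_iff.2 fun x hx => ?_
  obtain ⟨f, rfl⟩ := Submodule.Quotient.mk_surjective _ x
  rw [Submodule.Quotient.mk_eq_zero, mem_monIdeal hP]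
  intro u hu
  by_contra hcon
  obtain ⟨v, hv⟩ := h u hcon
  have h1 := hx (X v) (Ideal.subset_span ⟨v, rfl⟩)
  rw [← Submodule.Quotient.mk_smul, Submodule.Quotient.mk_eq_zero, smul_eq_mul, X,
    monomial_mul_mem_monIdeal hP, mem_monIdeal (isUpperSet_colon hP _)] at h1
  exact hv (h1 u hu)

theorem not_one_maximal : ¬ DepthGE k 1 {u : σ →₀ ℕ | u ≠ 0} := by
  have hP : IsUpperSet {u : σ →₀ ℕ | u ≠ 0} := by
    rintro s u hsu hs rfl
    exact hs (le_antisymm hsu zero_le)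
  intro h
  have h1 := ExtVanishing.one_iff.1 h (Submodule.Quotient.mk 1) (fun s hs => by
    rw [← Submodule.Quotient.mk_smul, Submodule.Quotient.mk_eq_zero, smul_eq_mul, mul_one]
    refine (Ideal.span_le.2 ?_ : maxHomIdeal k σ ≤ _) hs
    rintro _ ⟨v, rfl⟩
    exact monomial_mem_monIdeal (by simp) 1)
  rw [Submodule.Quotient.mk_eq_zero, mem_monIdeal hP] at h1
  exact h1 0 (by simp) rfl

/-- Adding a set of variables that do not occur lowers the depth by at most their number. -/
theorem union_variables (s : Finset σ) : ∀ {n : ℕ} {P : Set (σ →₀ ℕ)}, IsUpperSet P →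
    (∀ v ∈ s, ∀ u, u + Finsupp.single v 1 ∈ P → u ∈ P) → DepthGE k (n + s.card) P →
    DepthGE k n (P ∪ {u | ∃ v ∈ s, u v ≠ 0}) := by
  classical
  induction s using Finset.induction_on with
  | empty => intro n P hP hs h; simpa using h
  | insert w s hw ih =>
    intro n P hP hs h
    rw [Finset.card_insert_of_notMem hw, ← add_assoc] at h
    have h1 := union_single hP w (hs w (Finset.mem_insert_self w s)) h
    have hP1 : IsUpperSet (P ∪ Set.Ici (Finsupp.single w 1)) := hP.union (isUpperSet_Ici _)
    have h2 := ih hP1 (fun v hv u hu => by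
      rcases hu with hu | hu
      · exact Or.inl (hs v (Finset.mem_insert_of_mem hv) u hu)
      · refine Or.inr ?_
        have hvw : v ≠ w := fun e => hw (e ▸ hv)
        simpa [hvw] using hu) h1
    convert h2 using 1
    ext u
    simp [Set.mem_union, or_assoc, Nat.one_le_iff_ne_zero]

theorem empty [Fintype σ] : DepthGE k (Fintype.card σ) (∅ : Set (σ →₀ ℕ)) := by
  classical
  have key : ∀ s : Finset σ, DepthGE k s.card {u : σ →₀ ℕ | ∃ v ∉ s, u v ≠ 0} := by
    intro s
    induction s using Finset.induction_on with
    | empty => exact zero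
    | insert w s hw ih =>
      rw [Finset.card_insert_of_notMem hw]
      have hup : IsUpperSet {u : σ →₀ ℕ | ∃ v ∉ insert w s, u v ≠ 0} := by
        rintro u u' hle ⟨v, hv, hu⟩
        exact ⟨v, hv, fun h0 => hu (Nat.eq_zero_of_le_zero (h0 ▸ hle v))⟩
      refine of_union_single hup w ?_ ?_
      · rintro u ⟨v, hv, hu⟩
        have hvw : v ≠ w := fun e => hv (e ▸ Finset.mem_insert_self w s)
        exact ⟨v, hv, by simpa [hvw] using hu⟩
      · convert ih using 1
        ext u
        simp only [Set.mem_union, Set.mem_ofPred_eq, Set.mem_Ici, Finsupp.single_le_iff,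
          Finset.mem_insert, not_or, Nat.one_le_iff_ne_zero]
        constructor
        · rintro (⟨v, ⟨-, hv⟩, hu⟩ | hu)
          · exact ⟨v, hv, hu⟩
          · exact ⟨w, hw, hu⟩
        · rintro ⟨v, hv, hu⟩
          by_cases hvw : v = w
          · exact Or.inr (hvw ▸ hu)
          · exact Or.inl ⟨v, ⟨hvw, hv⟩, hu⟩
  have := key Finset.univ
  simpa using this

end DepthGE
end

section

variable {V : Type} {T : SimpleGraph V}

/-- A finite set of pairwise nonadjacent vertices. -/
def IndepFinset (T : SimpleGraph V) (A : Finset V) : Prop := ∀ i ∈ A, ∀ j ∈ A, ¬ T.Adj i j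

theorem IndepFinset.mono {A B : Finset V} (h : IndepFinset T A) (hB : B ⊆ A) : IndepFinset T B :=
  fun i hi j hj => h i (hB hi) j (hB hj)

theorem IndepFinset.empty : IndepFinset T (∅ : Finset V) := by simp [IndepFinset]

variable [DecidableEq V]

theorem IndepFinset.insert {A : Finset V} (h : IndepFinset T A) {i : V}
    (hi : ∀ j ∈ A, ¬ T.Adj i j) : IndepFinset T (insert i A) := by
  intro a ha b hb hab
  rw [Finset.mem_insert] at ha hb
  rcases ha with rfl | ha <;> rcases hb with rfl | hb
  · exact T.irrefl hab
  · exact hi b hb hab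
  · exact hi a ha hab.symm
  · exact h a ha b hb hab

/-- The contribution of the vertex `i` to the weight of the monomial `u` along the minimal vertex
cover determined by the independent set `A`, corrected by `γ`. -/
def gain (γ : V → ℤ) (A : Finset V) (u : V ⊕ V →₀ ℕ) (i : V) : ℤ :=
  if i ∈ A then u (Sum.inr i) - γ i else u (Sum.inl i)

/-- Exponents whose corrected weight on `W` is at least `c` along every minimal vertex cover. -/
def coverSet (T : SimpleGraph V) (W : Finset V) (c : ℤ) (γ : V → ℤ) : Set (V ⊕ V →₀ ℕ) :=
  {u | ∀ A, IndepFinset T A → c ≤ ∑ i ∈ W, gain γ A u i}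

theorem gain_mono {γ : V → ℤ} {A : Finset V} {u u' : V ⊕ V →₀ ℕ} (h : u ≤ u') (i : V) :
    gain γ A u i ≤ gain γ A u' i := by
  have h1 := h (Sum.inl i)
  have h2 := h (Sum.inr i)
  unfold gain
  split_ifs <;> omega

theorem isUpperSet_coverSet (W : Finset V) (c : ℤ) (γ : V → ℤ) :
    IsUpperSet (coverSet T W c γ) :=
  fun _ _ h hu A hA => (hu A hA).trans (Finset.sum_le_sum fun i _ => gain_mono h i)

theorem neg_max_le_gain (γ : V → ℤ) (A : Finset V) (u : V ⊕ V →₀ ℕ) (i : V) :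
    -max (γ i) 0 ≤ gain γ A u i := by
  unfold gain
  split_ifs <;> omega

theorem gain_congr {γ : V → ℤ} {A B : Finset V} {u : V ⊕ V →₀ ℕ} {i : V} (h : i ∈ A ↔ i ∈ B) :
    gain γ A u i = gain γ B u i := by
  unfold gain; simp only [h]

theorem add_single_inl_mem_coverSet {W : Finset V} {c : ℤ} {γ : V → ℤ} {i : V} (hi : i ∈ W)
    (p : ℕ) (u : V ⊕ V →₀ ℕ) : u + Finsupp.single (Sum.inl i) p ∈ coverSet T W c γ ↔
      u ∈ coverSet T W (c - p) (γ + Pi.single i (p : ℤ)) := by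
  refine forall₂_congr fun A _ => ?_
  have : ∀ j ∈ W, gain γ A (u + Finsupp.single (Sum.inl i) p) j =
      gain (γ + Pi.single i (p : ℤ)) A u j + if i = j then (p : ℤ) else 0 := by
    intro j _
    by_cases h : i = j
    · subst h; simp [gain]; split_ifs <;> ring
    · simp [gain, h, Ne.symm h]
  rw [Finset.sum_congr rfl this, Finset.sum_add_distrib, Finset.sum_ite_eq, if_pos hi,
    sub_le_iff_le_add]

theorem add_single_inr_mem_coverSet {W : Finset V} {c : ℤ} {γ : V → ℤ} (i : V)
    (p : ℕ) (u : V ⊕ V →₀ ℕ) : u + Finsupp.single (Sum.inr i) p ∈ coverSet T W c γ ↔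
      u ∈ coverSet T W c (γ - Pi.single i (p : ℤ)) := by
  refine forall₂_congr fun A _ => ?_
  have : ∀ j ∈ W, gain γ A (u + Finsupp.single (Sum.inr i) p) j =
      gain (γ - Pi.single i (p : ℤ)) A u j := by
    intro j _
    by_cases h : i = j
    · subst h; simp [gain]; split_ifs <;> ring
    · simp [gain, Ne.symm h]
  rw [Finset.sum_congr rfl this]

theorem coverSet_congr {W : Finset V} {c : ℤ} {γ : V → ℤ} {u u' : V ⊕ V →₀ ℕ}
    (h : ∀ i ∈ W, u (Sum.inl i) = u' (Sum.inl i) ∧ u (Sum.inr i) = u' (Sum.inr i)) :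
    u ∈ coverSet T W c γ ↔ u' ∈ coverSet T W c γ := by
  refine forall₂_congr fun A _ => ?_
  rw [Finset.sum_congr rfl fun j hj => ?_]
  simp only [gain, (h j hj).1, (h j hj).2]

variable {k : Type} [Field k] {n : ℕ}

theorem coverSet_eq_univ {W : Finset V} {c : ℤ} {γ : V → ℤ}
    (h : c + ∑ i ∈ W, max (γ i) 0 ≤ 0) : coverSet T W c γ = Set.univ := by
  refine Set.eq_univ_of_forall fun u A _ => ?_
  have := Finset.sum_le_sum fun i (_ : i ∈ W) => neg_max_le_gain γ A u i
  rw [Finset.sum_neg_distrib] at this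
  linarith

theorem coverSet_empty {c : ℤ} {γ : V → ℤ} (h : 1 ≤ c) : coverSet T ∅ c γ = ∅ := by
  refine Set.eq_empty_of_forall_notMem fun u hu => ?_
  have := hu ∅ IndepFinset.empty
  simp only [Finset.sum_empty] at this
  omega

theorem DepthGE.coverSet_of_nonpos {W : Finset V} {c : ℤ} {γ : V → ℤ} {i : V} (hi : i ∈ W)
    (hγ : γ i ≤ 0) (h₁ : DepthGE k n (coverSet T W (c - 1) (γ + Pi.single i 1)))
    (h₂ : DepthGE k (n + 1) (coverSet T (W.erase i) c γ)) : DepthGE k n (coverSet T W c γ) := by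
  refine of_colon_of_union (isUpperSet_coverSet W c γ) (Finsupp.single (Sum.inl i) 1) ?_ ?_
  · convert h₁ using 1
    ext u
    exact_mod_cast add_single_inl_mem_coverSet hi 1 u
  · have h3 := union_single (isUpperSet_coverSet _ c γ) (Sum.inl i) (fun u hu => by
      refine (coverSet_congr fun j hj => ?_).1 hu
      have : i ≠ j := (Finset.ne_of_mem_erase hj).symm
      simp [this]) h₂
    convert h3 using 1
    ext u
    simp only [Set.mem_union, Set.mem_Ici, Finsupp.single_le_iff]
    by_cases hu : 1 ≤ u (Sum.inl i)
    · simp [hu]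
    simp only [hu, or_false]
    constructor
    · intro h A hA
      have h4 := h (A.erase i) (hA.mono (Finset.erase_subset i A))
      rw [← Finset.add_sum_erase _ _ hi] at h4
      have h5 : gain γ (A.erase i) u i = 0 := by simp [gain]; omega
      rw [h5, zero_add] at h4
      refine h4.trans_eq (Finset.sum_congr rfl fun j hj => gain_congr ?_)
      simp [Finset.ne_of_mem_erase hj]
    · intro h A hA
      rw [← Finset.add_sum_erase _ _ hi]
      have := neg_max_le_gain γ A u i
      rw [max_eq_right hγ] at this
      have := h A hA
      linarith

theorem DepthGE.coverSet_of_isolated {W : Finset V} {c : ℤ} {γ : V → ℤ} {i : V} (hi : i ∈ W)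
    (hγ : 0 ≤ γ i) (hadj : ∀ j ∈ W, ¬ T.Adj i j)
    (h₁ : DepthGE k n (coverSet T W c (γ - Pi.single i 1)))
    (h₂ : DepthGE k (n + 1) (coverSet T (W.erase i) (c + γ i) γ)) :
    DepthGE k n (coverSet T W c γ) := by
  refine of_colon_of_union (isUpperSet_coverSet W c γ) (Finsupp.single (Sum.inr i) 1) ?_ ?_
  · convert h₁ using 1
    ext u
    exact_mod_cast add_single_inr_mem_coverSet i 1 u
  · have h3 := union_single (isUpperSet_coverSet _ (c + γ i) γ) (Sum.inr i) (fun u hu => by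
      refine (coverSet_congr fun j hj => ?_).1 hu
      have : i ≠ j := (Finset.ne_of_mem_erase hj).symm
      simp [this]) h₂
    convert h3 using 1
    ext u
    simp only [Set.mem_union, Set.mem_Ici, Finsupp.single_le_iff]
    by_cases hu : 1 ≤ u (Sum.inr i)
    · simp [hu]
    simp only [hu, or_false]
    constructor
    · intro h A hA
      have h4 := h (insert i (A ∩ W)) ((hA.mono Finset.inter_subset_left).insert
        fun j hj => hadj j (Finset.mem_of_mem_inter_right hj))
      rw [← Finset.add_sum_erase _ _ hi] at h4
      have h5 : gain γ (insert i (A ∩ W)) u i = - γ i := by simp [gain]; omega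
      have h6 : ∑ j ∈ W.erase i, gain γ (insert i (A ∩ W)) u j =
          ∑ j ∈ W.erase i, gain γ A u j :=
        Finset.sum_congr rfl fun j hj => gain_congr (by
          simp [Finset.ne_of_mem_erase hj, Finset.mem_of_mem_erase hj])
      rw [h6] at h4
      linarith
    · intro h A hA
      rw [← Finset.add_sum_erase _ _ hi]
      have := neg_max_le_gain γ A u i
      rw [max_eq_left hγ] at this
      have := h A hA
      linarith

theorem DepthGE.coverSet_of_leaf {W : Finset V} {c : ℤ} {γ : V → ℤ} {i j : V} (hi : i ∈ W)
    (hj : j ∈ W) (hγ : 0 ≤ γ i) (hij : T.Adj i j) (hadj : ∀ l ∈ W, T.Adj i l → l = j)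
    (h₁ : DepthGE k n (coverSet T W c (γ - Pi.single i 1)))
    (h₂ : ∀ p : ℕ, DepthGE k (n + 2)
      (coverSet T (W.erase i) (c + γ i) (γ - Pi.single j (γ i + p)))) :
    DepthGE k n (coverSet T W c γ) := by
  have hne : i ≠ j := hij.ne
  have hj' : j ∈ W.erase i := Finset.mem_erase.2 ⟨hne.symm, hj⟩
  -- sums of gains with respect to the modified corrections
  have hsum : ∀ (A : Finset V) (u : V ⊕ V →₀ ℕ) (p : ℕ),
      ∑ l ∈ W.erase i, gain (γ - Pi.single j (γ i + p)) A u l =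
        ∑ l ∈ W.erase i, gain γ A u l + if j ∈ A then γ i + p else 0 := by
    intro A u p
    rw [← Finset.add_sum_erase _ _ hj', ← Finset.add_sum_erase _ (gain γ A u) hj']
    have h5 : ∑ l ∈ (W.erase i).erase j, gain (γ - Pi.single j (γ i + p)) A u l =
        ∑ l ∈ (W.erase i).erase j, gain γ A u l :=
      Finset.sum_congr rfl fun l hl => by simp [gain, Finset.ne_of_mem_erase hl]
    rw [h5]
    simp only [gain, Pi.sub_apply, Pi.single_eq_same]
    split_ifs <;> ring
  have hins : ∀ A, IndepFinset T A → j ∉ A → IndepFinset T (insert i (A ∩ W)) := by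
    intro A hA hjA
    refine (hA.mono Finset.inter_subset_left).insert fun l hl hil => ?_
    rw [Finset.mem_inter] at hl
    exact hjA (hadj l hl.2 hil ▸ hl.1)
  have hinsum : ∀ (A : Finset V) (u : V ⊕ V →₀ ℕ),
      ∑ l ∈ W.erase i, gain γ (insert i (A ∩ W)) u l = ∑ l ∈ W.erase i, gain γ A u l :=
    fun A u => Finset.sum_congr rfl fun l hl => gain_congr (by
      simp [Finset.ne_of_mem_erase hl, Finset.mem_of_mem_erase hl])
  have hersum : ∀ (A : Finset V) (u : V ⊕ V →₀ ℕ) (p : ℕ),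
      ∑ l ∈ W.erase i, gain γ A (u + Finsupp.single (Sum.inl i) p) l =
        ∑ l ∈ W.erase i, gain γ A u l :=
    fun A u p => Finset.sum_congr rfl fun l hl => by
      simp [gain, (Finset.ne_of_mem_erase hl).symm]
  have hQR : ∀ (p : ℕ) (u : V ⊕ V →₀ ℕ), u (Sum.inr i) = 0 →
      (u (Sum.inl i) = 0 ∨ c + ∑ l ∈ W, max (γ l) 0 ≤ p) →
      (u + Finsupp.single (Sum.inl i) p ∈ coverSet T W c γ ↔
        u ∈ coverSet T (W.erase i) (c + γ i) (γ - Pi.single j (γ i + p))) := by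
    intro p u hy hx
    have hbig : ∀ A, c + ∑ l ∈ W, max (γ l) 0 ≤ p → c ≤ p + ∑ l ∈ W.erase i, gain γ A u l := by
      intro A hp
      have h6 := Finset.sum_le_sum fun l (_ : l ∈ W.erase i) => neg_max_le_gain γ A u l
      rw [Finset.sum_neg_distrib] at h6
      rw [← Finset.add_sum_erase _ _ hi] at hp
      have : 0 ≤ max (γ i) 0 := le_max_right _ _
      linarith
    have hgi : ∀ A, gain γ A (u + Finsupp.single (Sum.inl i) p) i =
        if i ∈ A then - γ i else u (Sum.inl i) + p := by
      intro A
      simp [gain, hy]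
    constructor
    · intro h A hA
      rw [hsum]
      by_cases hjA : j ∈ A
      · rw [if_pos hjA]
        suffices c ≤ p + ∑ l ∈ W.erase i, gain γ A u l by linarith
        rcases hx with hx | hx
        · have hiA : i ∉ A := fun hiA => hA i hiA j hjA hij
          have h4 := h A hA
          rw [← Finset.add_sum_erase _ _ hi, hersum, hgi, if_neg hiA, hx] at h4
          simpa using h4
        · exact hbig A hx
      · have h4 := h _ (hins A hA hjA)
        rw [← Finset.add_sum_erase _ _ hi, hersum, hgi, if_pos (Finset.mem_insert_self _ _),
          hinsum] at h4
        rw [if_neg hjA]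
        linarith
    · intro h A hA
      have h4 := h A hA
      rw [hsum] at h4
      rw [← Finset.add_sum_erase _ _ hi, hersum, hgi]
      by_cases hiA : i ∈ A
      · have hjA : j ∉ A := fun hjA => hA i hiA j hjA hij
        rw [if_neg hjA] at h4
        rw [if_pos hiA]
        linarith
      · rw [if_neg hiA]
        by_cases hjA : j ∈ A
        · rw [if_pos hjA] at h4
          have : (0 : ℤ) ≤ u (Sum.inl i) := by positivity
          linarith
        · rw [if_neg hjA] at h4
          have : (0 : ℤ) ≤ u (Sum.inl i) := by positivity
          linarith
  let Q : ℕ → Set (V ⊕ V →₀ ℕ) := fun p =>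
    {u | u + Finsupp.single (Sum.inl i) p ∈ coverSet T W c γ} ∪ Set.Ici (Finsupp.single (Sum.inr i) 1)
  have hQup : ∀ p, IsUpperSet (Q p) := fun p =>
    (isUpperSet_colon (isUpperSet_coverSet W c γ) _).union (isUpperSet_Ici _)
  have hreg : ∀ (p : ℕ), ∀ v ∈ ({Sum.inl i, Sum.inr i} : Finset (V ⊕ V)),
      ∀ u, u + Finsupp.single v 1 ∈
        coverSet T (W.erase i) (c + γ i) (γ - Pi.single j (γ i + p)) →
      u ∈ coverSet T (W.erase i) (c + γ i) (γ - Pi.single j (γ i + p)) := by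
    intro p v hv u hu
    refine (coverSet_congr fun l hl => ?_).1 hu
    have : i ≠ l := (Finset.ne_of_mem_erase hl).symm
    simp only [Finset.mem_insert, Finset.mem_singleton] at hv
    rcases hv with rfl | rfl <;> simp [this]
  have hQ : ∀ q p : ℕ, c + ∑ l ∈ W, max (γ l) 0 ≤ (p + q : ℕ) → DepthGE k n (Q p) := by
    intro q
    induction q with
    | zero =>
      intro p hp
      have h3 := union_single (isUpperSet_coverSet _ _ _) (Sum.inr i)
        (hreg p _ (by simp)) ((h₂ p).mono (Nat.le_succ _))
      convert h3 using 1
      ext u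
      simp only [Q, Set.mem_union, Set.mem_Ici, Finsupp.single_le_iff, Set.mem_ofPred_eq]
      by_cases hu : 1 ≤ u (Sum.inr i)
      · simp [hu]
      · simp only [hu, or_false]
        exact hQR p u (by omega) (Or.inr (by simpa using hp))
    | succ q ih =>
      intro p hp
      refine of_colon_of_union (hQup p) (Finsupp.single (Sum.inl i) 1) ?_ ?_
      · convert ih (p + 1) (by rwa [add_right_comm]) using 1
        ext u
        simp [Q, add_assoc, ← Finsupp.single_add, add_comm 1 p]
      · have h3 := union_variables {Sum.inl i, Sum.inr i} (isUpperSet_coverSet _ _ _)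
          (hreg p) (n := n) (by simpa using h₂ p)
        convert h3 using 1
        ext u
        simp only [Q, Set.mem_union, Set.mem_Ici, Finsupp.single_le_iff, Set.mem_ofPred_eq,
          Finset.mem_insert, Finset.mem_singleton, exists_eq_or_imp, exists_eq_left,
          Nat.one_le_iff_ne_zero]
        by_cases hx : u (Sum.inl i) = 0
        · by_cases hy : u (Sum.inr i) = 0
          · simp only [hx, hy, ne_eq, not_true, or_false]
            exact hQR p u hy (Or.inl hx)
          · simp [hy]
        · simp [hx]
  refine of_colon_of_union (isUpperSet_coverSet W c γ) (Finsupp.single (Sum.inr i) 1) ?_ ?_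
  · convert h₁ using 1
    ext u
    exact_mod_cast add_single_inr_mem_coverSet i 1 u
  · have h0 := hQ (c + ∑ l ∈ W, max (γ l) 0).toNat 0 (by
      rw [zero_add]; exact Int.self_le_toNat _)
    simpa [Q] using h0

end

section

variable {V : Type} {T : SimpleGraph V} [DecidableEq V] {k : Type} [Field k] {n : ℕ}

theorem DepthGE.coverSet [Fintype V]
    (hT : ∀ W : Finset V, W.Nonempty → ∃ i ∈ W, ∀ j ∈ W, ∀ l ∈ W, T.Adj i j → T.Adj i l → j = l)
    (W : Finset V) (c : ℤ) (γ : V → ℤ)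
    (hn : (n : ℤ) ≤ 2 * Fintype.card V - W.card + 1 - c - ∑ i ∈ W, max (γ i) 0) :
    DepthGE k n (coverSet T W c γ) := by
  obtain ⟨w, hw⟩ : ∃ w, w = W.card := ⟨_, rfl⟩
  obtain ⟨e, he⟩ : ∃ e, e = (c + ∑ i ∈ W, max (γ i) 0).toNat := ⟨_, rfl⟩
  obtain ⟨r, hr⟩ : ∃ r, r = (∑ i ∈ W, max (1 - γ i) 0).toNat := ⟨_, rfl⟩
  induction w using Nat.strong_induction_on generalizing W c γ e r n with | _ w ihw
  induction e using Nat.strong_induction_on generalizing c γ r with | _ e ihe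
  induction r using Nat.strong_induction_on generalizing c γ with | _ r ihr
  subst hw
  by_cases hpos : c + ∑ i ∈ W, max (γ i) 0 ≤ 0
  · rw [coverSet_eq_univ hpos]
    exact univ
  push Not at hpos
  rcases W.eq_empty_or_nonempty with rfl | hW
  · rw [coverSet_empty (by simp only [Finset.sum_empty] at hpos; omega)]
    refine (DepthGE.empty (σ := V ⊕ V)).mono ?_
    simp only [Finset.sum_empty, Finset.card_empty, add_zero] at hn hpos
    rw [Fintype.card_sum]
    push_cast at hn
    omega
  have hcard : ∀ i ∈ W, (W.erase i).card + 1 = W.card := fun i hi =>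
    Finset.card_erase_add_one hi
  have hlt : ∀ i ∈ W, (W.erase i).card < W.card := fun i hi => Finset.card_erase_lt_of_mem hi
  have hle : ∀ i ∈ W, max (γ i) 0 ≤ ∑ i ∈ W, max (γ i) 0 := fun i hi =>
    Finset.single_le_sum (f := fun i => max (γ i) 0) (fun _ _ => le_max_right _ _) hi
  by_cases hex : ∃ i ∈ W, γ i ≤ 0
  · obtain ⟨i, hi, hγ⟩ := hex
    have hs : ∑ j ∈ W, max ((γ + Pi.single i 1 : V → ℤ) j) 0 + max (γ i) 0 =
        ∑ j ∈ W, max (γ j) 0 + max (γ i + 1) 0 := by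
      rw [← Finset.add_sum_erase _ _ hi, ← Finset.add_sum_erase _ (fun j => max (γ j) 0) hi]
      have : ∑ j ∈ W.erase i, max ((γ + Pi.single i 1 : V → ℤ) j) 0 = ∑ j ∈ W.erase i, max (γ j) 0 :=
        Finset.sum_congr rfl fun j hj => by simp [Finset.ne_of_mem_erase hj]
      rw [this]
      simp only [Pi.add_apply, Pi.single_eq_same]
      ring
    refine DepthGE.coverSet_of_nonpos hi hγ ?_ ?_
    · have hb : (n : ℤ) ≤ 2 * Fintype.card V - W.card + 1 - (c - 1) -
          ∑ j ∈ W, max ((γ + Pi.single i 1 : V → ℤ) j) 0 := by omega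
      rcases hγ.lt_or_eq with hlt0 | h0
      · exact ihe _ (by omega) _ _ hb rfl _ rfl
      · refine ihr _ ?_ _ _ hb (by omega) rfl
        have hs' : ∑ j ∈ W, max (1 - (γ + Pi.single i 1 : V → ℤ) j) 0 + 1 =
            ∑ j ∈ W, max (1 - γ j) 0 := by
          rw [← Finset.add_sum_erase _ _ hi, ← Finset.add_sum_erase _ (fun j => max (1 - γ j) 0) hi]
          have : ∑ j ∈ W.erase i, max (1 - (γ + Pi.single i 1 : V → ℤ) j) 0 =
              ∑ j ∈ W.erase i, max (1 - γ j) 0 :=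
            Finset.sum_congr rfl fun j hj => by simp [Finset.ne_of_mem_erase hj]
          rw [this]
          simp [h0]
          ring
        have : 0 ≤ ∑ j ∈ W, max (1 - (γ + Pi.single i 1 : V → ℤ) j) 0 :=
          Finset.sum_nonneg fun _ _ => le_max_right _ _
        omega
    · refine ihw _ (hlt i hi) _ _ _ ?_ rfl _ rfl _ rfl
      have h1 := hcard i hi
      have h2 := Finset.add_sum_erase W (fun j => max (γ j) 0) hi
      simp only [max_eq_right hγ, zero_add] at h2
      push_cast
      omega
  push Not at hex
  obtain ⟨i, hi, hleaf⟩ := hT W hW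
  have hγi := hex i hi
  have h2 := Finset.add_sum_erase W (fun j => max (γ j) 0) hi
  simp only [max_eq_left hγi.le] at h2
  have hs : ∑ j ∈ W, max ((γ - Pi.single i 1 : V → ℤ) j) 0 + 1 = ∑ j ∈ W, max (γ j) 0 := by
    rw [← Finset.add_sum_erase _ _ hi, ← h2]
    have : ∑ j ∈ W.erase i, max ((γ - Pi.single i 1 : V → ℤ) j) 0 = ∑ j ∈ W.erase i, max (γ j) 0 :=
      Finset.sum_congr rfl fun j hj => by simp [Finset.ne_of_mem_erase hj]
    rw [this]
    simp only [Pi.sub_apply, Pi.single_eq_same]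
    rw [max_eq_left (by omega)]
    ring
  have h₁ : DepthGE k n (_root_.coverSet T W c (γ - Pi.single i 1)) :=
    ihe _ (by omega) _ _ (by omega) rfl _ rfl
  by_cases hj : ∃ j ∈ W, T.Adj i j
  · obtain ⟨j, hj, hij⟩ := hj
    refine DepthGE.coverSet_of_leaf hi hj hγi.le hij
      (fun l hl hil => hleaf l hl j hj hil hij) h₁ fun p => ?_
    refine ihw _ (hlt i hi) _ _ _ ?_ rfl _ rfl _ rfl
    have h1 := hcard i hi
    have hj' : j ∈ W.erase i := Finset.mem_erase.2 ⟨hij.ne.symm, hj⟩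
    have h3 : ∑ l ∈ W.erase i, max ((γ - Pi.single j (γ i + p) : V → ℤ) l) 0 + 1 ≤
        ∑ l ∈ W.erase i, max (γ l) 0 := by
      rw [← Finset.add_sum_erase _ _ hj', ← Finset.add_sum_erase _ (fun l => max (γ l) 0) hj']
      have : ∑ l ∈ (W.erase i).erase j, max ((γ - Pi.single j (γ i + p) : V → ℤ) l) 0 =
          ∑ l ∈ (W.erase i).erase j, max (γ l) 0 :=
        Finset.sum_congr rfl fun l hl => by simp [Finset.ne_of_mem_erase hl]
      rw [this]
      have hγj := hex j hj
      simp only [Pi.sub_apply, Pi.single_eq_same]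
      have : max (γ j - (γ i + p)) 0 + 1 ≤ max (γ j) 0 := by omega
      omega
    push_cast
    omega
  · push Not at hj
    refine DepthGE.coverSet_of_isolated hi hγi.le hj h₁ ?_
    refine ihw _ (hlt i hi) _ _ _ ?_ rfl _ rfl _ rfl
    have h1 := hcard i hi
    push_cast
    omega

end

section

variable {V : Type} {T : SimpleGraph V}

theorem SimpleGraph.IsAcyclic.exists_subsingleton_neighbors [Finite V] (hT : T.IsAcyclic)
    (W : Finset V) (hW : W.Nonempty) :
    ∃ i ∈ W, ∀ j ∈ W, ∀ l ∈ W, T.Adj i j → T.Adj i l → j = l := by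
  classical
  obtain ⟨w, hw⟩ := hW
  have : Fintype V := Fintype.ofFinite V
  let H := T.induce (W : Set V)
  let w' : (W : Set V) := ⟨w, hw⟩
  let c := H.connectedComponentMk w'
  have hc : c.toSimpleGraph.IsTree := (hT.induce _).isTree_connectedComponent c
  rcases subsingleton_or_nontrivial c.supp with hs | hs
  · refine ⟨w, hw, fun j hj l hl h1 h2 => ?_⟩
    have hj' : (⟨j, hj⟩ : (W : Set V)) ∈ c.supp := by
      refine SimpleGraph.ConnectedComponent.sound (SimpleGraph.Adj.reachable ?_)
      exact h1.symm
    have := congrArg (fun x => x.1.1) (hs.elim ⟨⟨j, hj⟩, hj'⟩ ⟨w', rfl⟩)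
    exact absurd this h1.ne'
  · obtain ⟨i, hi⟩ := hc.exists_vert_degree_one_of_nontrivial
    refine ⟨i.1.1, i.1.2, fun j hj l hl h1 h2 => ?_⟩
    have key : ∀ j (hj : j ∈ W), T.Adj i.1.1 j → (⟨j, hj⟩ : (W : Set V)) ∈ c.supp := by
      intro j hj h
      refine (SimpleGraph.ConnectedComponent.sound (SimpleGraph.Adj.reachable ?_)).trans i.2
      exact h.symm
    obtain ⟨a, -, ha⟩ := SimpleGraph.degree_eq_one_iff_existsUnique_adj.1 hi
    have e1 := ha ⟨⟨j, hj⟩, key j hj h1⟩ h1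
    have e2 := ha ⟨⟨l, hl⟩, key l hl h2⟩ h2
    exact congrArg (fun x => x.1.1) (e1.trans e2.symm)

end

section

variable {V : Type} {T : SimpleGraph V} [DecidableEq V]

theorem gain_add (γ : V → ℤ) (A : Finset V) (u v : V ⊕ V →₀ ℕ) (i : V) :
    gain γ A (u + v) i = gain γ A u i + gain 0 A v i := by
  unfold gain
  split_ifs
  · simp; ring
  · simp

theorem sum_gain_single_inl [Fintype V] (A : Finset V) (i : V) :
    ∑ j, gain 0 A (Finsupp.single (Sum.inl i) 1) j = if i ∈ A then 0 else 1 := by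
  rw [Finset.sum_eq_single i (fun j _ hj => by simp [gain, Ne.symm hj]) (by simp)]
  simp [gain]

theorem sum_gain_single_inr [Fintype V] (A : Finset V) (i : V) :
    ∑ j, gain 0 A (Finsupp.single (Sum.inr i) 1) j = if i ∈ A then 1 else 0 := by
  rw [Finset.sum_eq_single i (fun j _ hj => by simp [gain, Ne.symm hj]) (by simp)]
  simp [gain]

/-- The exponents of the generators of the edge ideal of the whisker graph of `T`. -/
def edgeExponents (T : SimpleGraph V) : Set (V ⊕ V →₀ ℕ) :=
  {e | (∃ i j, T.Adj i j ∧ e = Finsupp.single (Sum.inl i) 1 + Finsupp.single (Sum.inl j) 1) ∨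
    ∃ i, e = Finsupp.single (Sum.inl i) 1 + Finsupp.single (Sum.inr i) 1}

theorem add_mem_coverSet_of_mem_edgeExponents [Fintype V] {t : ℤ} {u e : V ⊕ V →₀ ℕ}
    (hu : u ∈ coverSet T Finset.univ t 0) (he : e ∈ edgeExponents T) :
    u + e ∈ coverSet T Finset.univ (t + 1) 0 := by
  intro A hA
  simp only [gain_add, Finset.sum_add_distrib]
  refine add_le_add (hu A hA) ?_
  rcases he with ⟨i, j, hij, rfl⟩ | ⟨i, rfl⟩
  · simp only [gain_add, Finset.sum_add_distrib, sum_gain_single_inl]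
    have := hA i
    split_ifs with h1 h2
    · exact absurd hij (hA i h1 j h2)
    all_goals omega
  · simp only [gain_add, Finset.sum_add_distrib, sum_gain_single_inl, sum_gain_single_inr]
    split_ifs <;> omega

theorem exists_add_of_mem_coverSet_succ [Fintype V]
    (hT : ∀ W : Finset V, W.Nonempty → ∃ i ∈ W, ∀ j ∈ W, ∀ l ∈ W, T.Adj i j → T.Adj i l → j = l)
    {t : ℤ} (ht : 0 ≤ t) {u : V ⊕ V →₀ ℕ} (hu : u ∈ coverSet T Finset.univ (t + 1) 0) :
    ∃ u' ∈ coverSet T Finset.univ t 0, ∃ e ∈ edgeExponents T, u = u' + e := by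
  classical
  by_cases hxy : ∃ i, u (Sum.inl i) ≠ 0 ∧ u (Sum.inr i) ≠ 0
  · obtain ⟨i, h1, h2⟩ := hxy
    have hle : (Finsupp.single (Sum.inl i) 1 + Finsupp.single (Sum.inr i) 1 : V ⊕ V →₀ ℕ) ≤ u := by
      intro v
      rcases v with v | v
      · by_cases h : i = v
        · subst h; simp; omega
        · simp [h]
      · by_cases h : i = v
        · subst h; simp; omega
        · simp [h]
    obtain ⟨u', rfl⟩ := exists_add_of_le hle
    refine ⟨u', fun A hA => ?_, _, Or.inr ⟨i, rfl⟩, add_comm _ _⟩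
    have := hu A hA
    simp only [gain_add, Finset.sum_add_distrib, sum_gain_single_inl,
      sum_gain_single_inr] at this
    split_ifs at this <;> omega
  push Not at hxy
  have hP : ∃ i ∈ {i | u (Sum.inl i) ≠ 0}, ∃ j, u (Sum.inl j) ≠ 0 ∧ T.Adj i j := by
    by_contra! hcon
    have := hu (Finset.univ.filter fun i => u (Sum.inl i) ≠ 0) fun i hi j hj => by
      simp only [Finset.mem_filter, Finset.mem_univ, true_and] at hi hj
      exact hcon i hi j hj
    rw [Finset.sum_eq_zero fun i _ => ?_] at this
    · omega
    · unfold gain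
      have := hxy i
      split_ifs with h
      · simp only [Finset.mem_filter, Finset.mem_univ, true_and] at h
        simp [this h]
      · simpa using h
  obtain ⟨i, hi, hleaf⟩ := hT
    (Finset.univ.filter fun i => u (Sum.inl i) ≠ 0 ∧ ∃ j, u (Sum.inl j) ≠ 0 ∧ T.Adj i j) <| by
      obtain ⟨i, hi, h⟩ := hP
      exact ⟨i, by simpa using ⟨hi, h⟩⟩
  simp only [Finset.mem_filter, Finset.mem_univ, true_and] at hi hleaf
  obtain ⟨hi0, j, hj0, hij⟩ := hi
  have huniq : ∀ l, u (Sum.inl l) ≠ 0 → T.Adj i l → l = j := fun l hl hil =>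
    hleaf l ⟨hl, i, hi0, hil.symm⟩ j ⟨hj0, i, hi0, hij.symm⟩ hil hij
  have hle : (Finsupp.single (Sum.inl i) 1 + Finsupp.single (Sum.inl j) 1 : V ⊕ V →₀ ℕ) ≤ u := by
    intro v
    have hne := hij.ne
    rcases v with v | v
    · by_cases h : i = v
      · subst h; simp [hne.symm]; omega
      · by_cases h' : j = v
        · subst h'; simp [h]; omega
        · simp [h, h']
    · simp
  obtain ⟨u', hu'⟩ := exists_add_of_le hle
  refine ⟨u', fun A hA => ?_, _, Or.inl ⟨i, j, hij, rfl⟩, by rw [hu', add_comm]⟩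
  have hsum : ∑ l, gain 0 A u l = ∑ l, gain 0 A u' l + ((if i ∈ A then 0 else 1) +
      if j ∈ A then 0 else 1) := by
    rw [hu']
    simp only [gain_add, Finset.sum_add_distrib, sum_gain_single_inl]
    ring
  have hA' := hu A hA
  by_cases h : i ∈ A ∨ j ∈ A
  · rcases h with h | h <;> simp only [h, if_true] at hsum <;> split_ifs at hsum <;> omega
  push Not at h
  simp only [h, if_false] at hsum
  have hB := hu (insert i (A.filter fun l => ¬ T.Adj i l))
    ((hA.mono (Finset.filter_subset _ _)).insert fun l hl => (Finset.mem_filter.1 hl).2)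
  have hlt : ∑ l, gain 0 (insert i (A.filter fun l => ¬ T.Adj i l)) u l < ∑ l, gain 0 A u l := by
    refine Finset.sum_lt_sum (fun l _ => ?_) ⟨i, Finset.mem_univ _, ?_⟩
    · by_cases hl : l = i
      · subst hl
        simp [gain, h.1, hxy l hi0]
      by_cases hil : T.Adj i l
      · by_cases hlA : l ∈ A
        · have : u (Sum.inl l) = 0 := by
            by_contra h0
            exact h.2 (huniq l h0 hil ▸ hlA)
          simp [gain, hl, hil, hlA, this]
        · simp [gain, hl, hil, hlA]
      · simp [gain, hl, hil]
    · simp [gain, h.1, hxy i hi0]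
      omega
  omega

theorem monIdeal_coverSet_eq_pow [Fintype V] {k : Type} [Field k]
    (hT : ∀ W : Finset V, W.Nonempty → ∃ i ∈ W, ∀ j ∈ W, ∀ l ∈ W, T.Adj i j → T.Adj i l → j = l)
    (t : ℕ) : monIdeal k (coverSet T Finset.univ t 0) = monIdeal k (edgeExponents T) ^ t := by
  induction t with
  | zero =>
    rw [coverSet_eq_univ (by simp), pow_zero, Ideal.one_eq_top, Ideal.eq_top_iff_one]
    exact monomial_mem_monIdeal (u := 0) (Set.mem_univ _) 1
  | succ t ih =>
    rw [pow_succ, ← ih]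
    unfold monIdeal
    rw [Ideal.span_mul_span']
    refine le_antisymm (Ideal.span_mono ?_) (Ideal.span_mono ?_)
    · rintro _ ⟨u, hu, rfl⟩
      obtain ⟨u', hu', e, he, rfl⟩ := exists_add_of_mem_coverSet_succ hT (Int.natCast_nonneg t)
        (by simpa using hu)
      exact ⟨_, ⟨u', hu', rfl⟩, _, ⟨e, he, rfl⟩, by simp [monomial_mul]⟩
    · rintro _ ⟨_, ⟨u, hu, rfl⟩, _, ⟨e, he, rfl⟩, rfl⟩
      exact ⟨u + e, by simpa using add_mem_coverSet_of_mem_edgeExponents hu he, by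
        simp [monomial_mul]⟩

theorem edgeIdeal_whiskerGraph {k : Type} [Field k] {d : ℕ} (T : SimpleGraph (Fin d)) :
    edgeIdeal k (whiskerGraph T) = monIdeal k (edgeExponents T) := by
  have hX : ∀ v w : Fin d ⊕ Fin d, (X v * X w : MvPolynomial _ k) =
      monomial (Finsupp.single v 1 + Finsupp.single w 1) 1 := fun v w => by
    simp [X, monomial_mul]
  unfold edgeIdeal monIdeal
  congr 1
  ext p
  simp only [whiskerGraph, SimpleGraph.fromRel_adj, Set.mem_image]
  constructor
  · rintro ⟨v, w, ⟨-, (⟨i, j, hij, rfl, rfl⟩ | ⟨i, rfl, rfl⟩) |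
      (⟨i, j, hij, rfl, rfl⟩ | ⟨i, rfl, rfl⟩)⟩, rfl⟩
    · exact ⟨_, Or.inl ⟨i, j, hij, rfl⟩, (hX _ _).symm⟩
    · exact ⟨_, Or.inr ⟨i, rfl⟩, (hX _ _).symm⟩
    · exact ⟨_, Or.inl ⟨j, i, hij.symm, rfl⟩, (hX _ _).symm⟩
    · exact ⟨_, Or.inr ⟨i, rfl⟩, by rw [mul_comm, hX]⟩
  · rintro ⟨_, ⟨i, j, hij, rfl⟩ | ⟨i, rfl⟩, rfl⟩
    · exact ⟨_, _, ⟨by simpa using hij.ne, Or.inl (Or.inl ⟨i, j, hij, rfl, rfl⟩)⟩, (hX _ _).symm⟩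
    · exact ⟨_, _, ⟨by simp, Or.inl (Or.inr ⟨i, rfl, rfl⟩)⟩, (hX _ _).symm⟩

end

section

variable {V : Type} {T : SimpleGraph V}

theorem SimpleGraph.Connected.exists_adj_mem_notMem (hT : T.Connected) {U : Finset V} {i j : V}
    (hi : i ∈ U) (hj : j ∉ U) : ∃ u ∈ U, ∃ v ∉ U, T.Adj u v := by
  obtain ⟨p⟩ := hT.preconnected i j
  obtain ⟨e, -, h1, h2⟩ := p.exists_boundary_dart (U : Set V) hi hj
  exact ⟨e.fst, h1, e.snd, h2, e.adj⟩

/-- A finite set `M` of independent vertices far from `U` that dominates every other vertex not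
adjacent to `U`. -/
theorem exists_maximal_indepFinset [Fintype V] (T : SimpleGraph V) (U : Finset V) :
    ∃ M, IndepFinset T M ∧ (∀ m ∈ M, m ∉ U ∧ ∀ u ∈ U, ¬ T.Adj m u) ∧
      ∀ l ∉ U, l ∉ M → (∃ u ∈ U, T.Adj l u) ∨ ∃ m ∈ M, T.Adj l m := by
  classical
  obtain ⟨M, hM, hmax⟩ := Finset.exists_max_image
    (Finset.univ.filter fun M : Finset V =>
      IndepFinset T M ∧ ∀ m ∈ M, m ∉ U ∧ ∀ u ∈ U, ¬ T.Adj m u) Finset.card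
    ⟨∅, by simp [IndepFinset.empty]⟩
  simp only [Finset.mem_filter, Finset.mem_univ, true_and] at hM hmax
  refine ⟨M, hM.1, hM.2, fun l hl hlM => ?_⟩
  by_contra! hcon
  have := hmax (insert l M) ⟨hM.1.insert hcon.2, fun m hm => by
    rcases Finset.mem_insert.1 hm with rfl | hm
    exacts [⟨hl, hcon.1⟩, hM.2 m hm]⟩
  rw [Finset.card_insert_of_notMem hlM] at this
  omega

variable [DecidableEq V]

/-- Doubling the edges of a connected set `U` of `t + 1` vertices gives weights for which the
independent sets of least complementary weight cut out exactly a colour class of `U`. -/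
theorem exists_colour_weights [Fintype V] (hT : T.Connected) (C : V → Bool)
    (hC : ∀ i j, T.Adj i j → C i ≠ C j) (i₀ : V) (t : ℕ) (ht : t < Fintype.card V) :
    ∃ (U : Finset V) (a : V → ℕ), U.card = t + 1 ∧ i₀ ∈ U ∧ (∀ i ∉ U, a i = 0) ∧
      (∀ A, IndepFinset T A → t ≤ ∑ i, if i ∈ A then 0 else a i) ∧
      (∀ A, IndepFinset T A → (∑ i, if i ∈ A then 0 else a i) ≤ t →
        ∃ b, ∀ i ∈ U, (i ∈ A ↔ C i = b)) ∧
      ∀ b, (∑ i, if C i = b then 0 else a i) = t := by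
  induction t with
  | zero =>
    refine ⟨{i₀}, 0, by simp, by simp, by simp, by simp, fun A _ _ => ?_, by simp⟩
    by_cases h : i₀ ∈ A
    · exact ⟨C i₀, by simpa using h⟩
    · exact ⟨!C i₀, by simpa using h⟩
  | succ t ih =>
    obtain ⟨U, a, hU, hi₀, ha, h1, h2, h3⟩ := ih (by omega)
    obtain ⟨j, hj⟩ : ∃ j, j ∉ U := by
      by_contra! h
      have := Finset.card_univ (α := V)
      rw [← Finset.eq_univ_of_forall h] at this
      omega
    obtain ⟨u, hu, v, hv, huv⟩ := hT.exists_adj_mem_notMem hi₀ hj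
    have hsum : ∀ p : V → Prop, ∀ [DecidablePred p],
        (∑ i, if p i then 0 else (a + Pi.single u 1 + Pi.single v 1 : V → ℕ) i) =
        (∑ i, if p i then 0 else a i) + ((if p u then 0 else 1) + if p v then 0 else 1) := by
      intro p _
      have : ∀ i, (if p i then 0 else (a + Pi.single u 1 + Pi.single v 1 : V → ℕ) i) =
          (if p i then 0 else a i) + ((if i = u then (if p u then 0 else 1) else 0) +
            if i = v then (if p v then 0 else 1) else 0) := by
        intro i
        have hne := huv.ne
        by_cases hiu : i = u
        · subst hiu; simp [hne]; split_ifs <;> simp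
        · by_cases hiv : i = v
          · subst hiv; simp [hiu]; split_ifs <;> simp
          · simp [hiu, hiv]
      simp only [this, Finset.sum_add_distrib, Finset.sum_ite_eq', Finset.mem_univ, if_true]
    have hCuv := hC u v huv
    refine ⟨insert v U, a + Pi.single u 1 + Pi.single v 1, by simp [hv, hU], by simp [hi₀],
      fun i hi => ?_, fun A hA => ?_, fun A hA hle => ?_, fun b => ?_⟩
    · rw [Finset.mem_insert, not_or] at hi
      have : i ≠ u := fun h => hi.2 (h ▸ hu)
      simp [hi.1, this, ha i hi.2]
    · rw [hsum (· ∈ A)]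
      have := h1 A hA
      have := hA u
      split_ifs with h h'
      · exact absurd huv (hA u h v h')
      all_goals omega
    · rw [hsum (· ∈ A)] at hle
      have := h1 A hA
      have huvA : u ∈ A ↔ v ∉ A := by
        constructor
        · exact fun h h' => hA u h v h' huv
        · intro h
          by_contra h'
          simp only [h, h', if_false] at hle
          omega
      obtain ⟨b, hb⟩ := h2 A hA (by
        by_cases h : v ∈ A
        · have : u ∉ A := fun h' => huvA.1 h' h
          simp only [h, this, if_true, if_false] at hle
          omega
        · simp only [h, huvA.2 h, if_true, if_false] at hle
          omega)
      refine ⟨b, fun i hi => ?_⟩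
      rcases Finset.mem_insert.1 hi with rfl | hi
      · have := hb u hu
        rw [huvA] at this
        have key : ∀ p q r : Bool, p ≠ q → (p = r ↔ ¬ q = r) := by decide
        rw [key _ _ b hCuv] at this
        exact not_iff_not.1 this
      · exact hb i hi
    · rw [hsum (C · = b), h3 b]
      have key : ∀ p q r : Bool, p ≠ q → (if p = r then 0 else 1) + (if q = r then 0 else 1) = 1 := by
        decide
      rw [key _ _ _ hCuv]

end

section

variable {V : Type} {T : SimpleGraph V} [DecidableEq V] [Fintype V]

theorem exists_sum_gain_single (A : Finset V) (v : V ⊕ V) :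
    ∃ ε : ℤ, (ε = 0 ∨ ε = 1) ∧ ∀ p : ℕ, ∑ j, gain 0 A (Finsupp.single v p) j = ε * p := by
  rcases v with i | i
  · refine ⟨if i ∈ A then 0 else 1, by split_ifs <;> simp, fun p => ?_⟩
    rw [Finset.sum_eq_single i (fun j _ hj => by simp [gain, Ne.symm hj]) (by simp)]
    simp [gain]
  · refine ⟨if i ∈ A then 1 else 0, by split_ifs <;> simp, fun p => ?_⟩
    rw [Finset.sum_eq_single i (fun j _ hj => by simp [gain, Ne.symm hj]) (by simp)]
    simp [gain]

variable {k : Type} [Field k] {n : ℕ} {c : ℤ} {γ : V → ℤ}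

theorem DepthGE.coverSet_colon (v : V ⊕ V) (h : DepthGE k n (_root_.coverSet T Finset.univ c γ)) :
    DepthGE k n {u | u + Finsupp.single v 1 ∈ _root_.coverSet T Finset.univ c γ} := by
  refine DepthGE.colon_single (isUpperSet_coverSet _ _ _) v
    (c + ∑ i, max (γ i) 0).toNat (fun u p hu A hA => ?_) h
  have hp := hu A hA
  obtain ⟨ε, hε, hs⟩ := exists_sum_gain_single A v
  simp only [gain_add, Finset.sum_add_distrib, hs] at hp ⊢
  have hmin : -∑ i, max (γ i) 0 ≤ ∑ i, gain γ A u i := by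
    rw [← Finset.sum_neg_distrib]
    exact Finset.sum_le_sum fun i _ => neg_max_le_gain γ A u i
  rcases hε with rfl | rfl
  · simpa using hp
  · have := Int.self_le_toNat (c + ∑ i, max (γ i) 0)
    omega

theorem DepthGE.coverSet_colon_inl (i : V) (p : ℕ)
    (h : DepthGE k n (_root_.coverSet T Finset.univ c γ)) :
    DepthGE k n (_root_.coverSet T Finset.univ (c - p) (γ + Pi.single i (p : ℤ))) := by
  induction p with
  | zero => simpa using h
  | succ p ih =>
    have := ih.coverSet_colon (Sum.inl i)
    simp only [add_single_inl_mem_coverSet (Finset.mem_univ i), Set.ofPred_mem_eq] at this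
    convert this using 2
    · push_cast; ring
    · rw [add_assoc, ← Pi.single_add]; push_cast; rfl

theorem DepthGE.coverSet_colon_inr (i : V)
    (h : DepthGE k n (_root_.coverSet T Finset.univ c γ)) :
    DepthGE k n (_root_.coverSet T Finset.univ c (γ - Pi.single i 1)) := by
  have := h.coverSet_colon (Sum.inr i)
  simpa only [add_single_inr_mem_coverSet, Nat.cast_one, Set.ofPred_mem_eq] using this

theorem DepthGE.coverSet_colon_prod (a : V → ℕ)
    (h : DepthGE k n (_root_.coverSet T Finset.univ c 0)) :
    DepthGE k n (_root_.coverSet T Finset.univ (c - ∑ i, a i) fun i => a i) := by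
  have key : ∀ s : Finset V, DepthGE k n (_root_.coverSet T Finset.univ (c - ∑ i ∈ s, (a i : ℤ))
      (∑ i ∈ s, Pi.single i (a i : ℤ))) := by
    intro s
    induction s using Finset.induction_on with
    | empty => simpa using h
    | insert i s hi ih =>
      rw [Finset.sum_insert hi, Finset.sum_insert hi, add_comm (Pi.single _ _),
        add_comm (a i : ℤ), ← sub_sub]
      exact ih.coverSet_colon_inl i (a i)
  have := key Finset.univ
  rw [Finset.univ_sum_single fun i => (a i : ℤ)] at this
  exact_mod_cast this

theorem DepthGE.one_coverSet [Nonempty V] :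
    DepthGE k 1 (_root_.coverSet T Finset.univ c γ) := by
  refine DepthGE.one_of_socle (isUpperSet_coverSet _ _ _) fun u hu => ?_
  simp only [_root_.coverSet, Set.mem_ofPred_eq, not_forall] at hu
  obtain ⟨A, hA, hlt⟩ := hu
  obtain ⟨i⟩ := ‹Nonempty V›
  refine ⟨if i ∈ A then Sum.inl i else Sum.inr i, fun h => hlt ?_⟩
  have := h A hA
  simp only [gain_add, Finset.sum_add_distrib] at this
  split_ifs at this with hi
  · simpa [sum_gain_single_inl, hi] using this
  · simpa [sum_gain_single_inr, hi] using this

end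

section

variable {V : Type} {T : SimpleGraph V} [DecidableEq V] [Fintype V] {k : Type} [Field k]

theorem sum_gain_eq_sub (γ : V → ℤ) (A : Finset V) (u : V ⊕ V →₀ ℕ) :
    ∑ i, gain γ A u i = ∑ i, gain 0 A u i - ∑ i ∈ A, γ i := by
  rw [eq_sub_iff_add_eq, ← Finset.sum_filter_add_sum_filter_not Finset.univ (· ∈ A) (gain γ A u),
    ← Finset.sum_filter_add_sum_filter_not Finset.univ (· ∈ A) (gain 0 A u)]
  have h1 : ∑ i with i ∈ A, gain 0 A u i = ∑ i with i ∈ A, gain γ A u i + ∑ i ∈ A, γ i := by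
    rw [Finset.filter_univ_mem, ← Finset.sum_add_distrib]
    exact Finset.sum_congr rfl fun i hi => by simp [gain, hi]
  have h2 : ∑ i with i ∉ A, gain 0 A u i = ∑ i with i ∉ A, gain γ A u i :=
    Finset.sum_congr rfl fun i hi => by
      have hi' := (Finset.mem_filter.1 hi).2
      simp [gain, hi']
  rw [h1, h2]
  ring

theorem mem_coverSet_univ_iff {c : ℤ} {γ : V → ℤ} {u : V ⊕ V →₀ ℕ} :
    u ∈ coverSet T Finset.univ c γ ↔
      ∀ A, IndepFinset T A → c + ∑ i ∈ A, γ i ≤ ∑ i, gain 0 A u i :=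
  forall₂_congr fun A _ => by rw [sum_gain_eq_sub, le_sub_iff_add_le]

theorem sum_gain_zero_nonneg (A : Finset V) (u : V ⊕ V →₀ ℕ) : 0 ≤ ∑ i, gain 0 A u i :=
  Finset.sum_nonneg fun i _ => by simpa using neg_max_le_gain 0 A u i

theorem one_le_sum_gain_inl {A : Finset V} {u : V ⊕ V →₀ ℕ} {i : V} (hi : i ∉ A)
    (hu : u (Sum.inl i) ≠ 0) : 1 ≤ ∑ i, gain 0 A u i := by
  refine le_trans ?_ (Finset.single_le_sum (f := gain 0 A u)
    (fun i _ => by simpa using neg_max_le_gain 0 A u i) (Finset.mem_univ i))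
  simp [gain, hi]
  omega

theorem one_le_sum_gain_inr {A : Finset V} {u : V ⊕ V →₀ ℕ} {i : V} (hi : i ∈ A)
    (hu : u (Sum.inr i) ≠ 0) : 1 ≤ ∑ i, gain 0 A u i := by
  refine le_trans ?_ (Finset.single_le_sum (f := gain 0 A u)
    (fun i _ => by simpa using neg_max_le_gain 0 A u i) (Finset.mem_univ i))
  simp [gain, hi]
  omega

/-- If every constraint of `coverSet` with a positive bound comes from a set in `𝓐` and has
bound one, then `coverSet` is cut out by the sets in `𝓐`. -/
theorem mem_coverSet_univ_iff_of_bound {c : ℤ} {γ : V → ℤ} {p : Finset V → Prop}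
    (h0 : ∀ A, IndepFinset T A → ¬ p A → c + ∑ i ∈ A, γ i ≤ 0)
    (h1 : ∀ A, IndepFinset T A → p A → c + ∑ i ∈ A, γ i = 1) {u : V ⊕ V →₀ ℕ} :
    u ∈ coverSet T Finset.univ c γ ↔
      ∀ A, IndepFinset T A → p A → 1 ≤ ∑ i, gain 0 A u i := by
  rw [mem_coverSet_univ_iff]
  refine forall₂_congr fun A hA => ?_
  by_cases hp : p A
  · simp [h1 A hA hp, hp]
  · simpa [hp] using (h0 A hA hp).trans (sum_gain_zero_nonneg A u)

theorem not_depthGE_coverSet_of_le_card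
    (hF : ∀ W : Finset V, W.Nonempty → ∃ i ∈ W, ∀ j ∈ W, ∀ l ∈ W, T.Adj i j → T.Adj i l → j = l)
    (hT : T.Connected) (C : V → Bool) (hC : ∀ i j, T.Adj i j → C i ≠ C j) {n t : ℕ} (ht : 1 ≤ t)
    (hn : n + t = Fintype.card V + 1) (hn1 : 1 ≤ n) :
    ¬ DepthGE k (n + 1) (coverSet T Finset.univ t 0) := by
  intro hD
  obtain ⟨i₀⟩ := hT.nonempty
  obtain ⟨s, rfl⟩ : ∃ s, t = s + 1 := ⟨t - 1, by omega⟩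
  obtain ⟨U, a, hU, hi₀, haU, ha1, ha2, ha3⟩ :=
    exists_colour_weights hT C hC i₀ s (by omega)
  obtain ⟨M, hM, hMU, hdom⟩ := exists_maximal_indepFinset T U
  -- the exponent of the monomial by which we take the colon ideal
  obtain ⟨a', ha'⟩ : ∃ a' : V → ℕ, a' = fun i => if i ∈ M then s + 1 else a i := ⟨_, rfl⟩
  have hDK := hD.coverSet_colon_prod a'
  obtain ⟨c, hc⟩ : ∃ c : ℤ, c = (s + 1 : ℕ) - ∑ i, (a' i : ℤ) := ⟨_, rfl⟩
  rw [Nat.cast_sum, ← hc] at hDK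
  have hbound : ∀ A : Finset V, c + ∑ i ∈ A, (a' i : ℤ) =
      s + 1 - (∑ i, if i ∈ A then 0 else a' i : ℕ) := by
    intro A
    rw [hc]
    have : (∑ i, (a' i : ℤ)) = ∑ i ∈ A, (a' i : ℤ) + (∑ i, if i ∈ A then 0 else a' i : ℕ) := by
      rw [← Finset.sum_filter_add_sum_filter_not Finset.univ (· ∈ A), Finset.filter_univ_mem,
        Finset.sum_filter]
      push_cast
      simp only [ite_not]
    rw [this]
    push_cast
    ring
  have haM : ∀ i ∈ M, a i = 0 := fun i hi => haU i (hMU i hi).1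
  have ha_le : ∀ A : Finset V, (∑ i, if i ∈ A then 0 else a i) ≤ ∑ i, if i ∈ A then 0 else a' i := by
    intro A
    refine Finset.sum_le_sum fun i _ => ?_
    rw [ha']
    dsimp only
    split_ifs with h1 h2
    · simp
    · simp [haM i h2]
    · simp
  have ha_eq : ∀ A : Finset V, M ⊆ A →
      (∑ i, if i ∈ A then 0 else a' i) = ∑ i, if i ∈ A then 0 else a i := by
    intro A hMA
    refine Finset.sum_congr rfl fun i _ => ?_
    rw [ha']
    dsimp only
    split_ifs with h1 h2
    · rfl
    · exact absurd (hMA h2) h1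
    · rfl
  have hM_lt : ∀ A : Finset V, ¬ M ⊆ A → s + 1 ≤ ∑ i, if i ∈ A then 0 else a' i := by
    intro A hMA
    obtain ⟨i, hi, hiA⟩ := Finset.not_subset.1 hMA
    refine le_trans ?_ (Finset.single_le_sum (f := fun i => if i ∈ A then 0 else a' i)
      (fun _ _ => Nat.zero_le _) (Finset.mem_univ i))
    simp [ha', hi, hiA]
  let p : Bool → Finset V → Prop := fun b A => M ⊆ A ∧ ∀ i ∈ U, (i ∈ A ↔ C i = b)
  have hp : ∀ A, IndepFinset T A → ∀ b, p b A → c + ∑ i ∈ A, (a' i : ℤ) = 1 := by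
    rintro A hA b ⟨hMA, hb⟩
    rw [hbound, ha_eq A hMA]
    have : (∑ i, if i ∈ A then 0 else a i) = s := by
      rw [← ha3 b]
      refine Finset.sum_congr rfl fun i _ => ?_
      by_cases hi : i ∈ U
      · simp only [hb i hi]
      · simp [haU i hi]
    omega
  have hnp : ∀ A, IndepFinset T A → (¬ ∃ b, p b A) → c + ∑ i ∈ A, (a' i : ℤ) ≤ 0 := by
    intro A hA hno
    rw [hbound]
    by_cases hMA : M ⊆ A
    · have : ¬ (∑ i, if i ∈ A then 0 else a i) ≤ s := fun hle => by
        obtain ⟨b, hb⟩ := ha2 A hA hle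
        exact hno ⟨b, hMA, hb⟩
      have := ha_le A
      omega
    · have := hM_lt A hMA
      omega
  let J : Bool → Set (V ⊕ V →₀ ℕ) := fun b =>
    {u | ∀ A, IndepFinset T A → p b A → 1 ≤ ∑ i, gain 0 A u i}
  have hK : coverSet T Finset.univ c (fun i => (a' i : ℤ)) = J true ∩ J false := by
    ext u
    rw [mem_coverSet_univ_iff_of_bound (p := fun A => ∃ b, p b A) hnp
      (fun A hA ⟨b, hb⟩ => hp A hA b hb)]
    refine ⟨fun h => ⟨fun A hA h' => h A hA ⟨_, h'⟩, fun A hA h' => h A hA ⟨_, h'⟩⟩, ?_⟩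
    rintro ⟨h1, h2⟩ A hA ⟨b | b, hb⟩
    exacts [h2 A hA hb, h1 A hA hb]
  -- each half is a cover set, so the lower bound applies to it
  obtain ⟨B, hB⟩ : ∃ B, B = U.filter fun i => C i = C i₀ := ⟨_, rfl⟩
  have hi₀B : i₀ ∈ B := by simp [hB, hi₀]
  have hsumB : ∀ A : Finset V, ∑ i ∈ A, (if i ∈ B then 1 else 0 : ℤ) = (A ∩ B).card := by
    intro A
    simp [Finset.sum_ite_mem]
  have hJ₁ : J (C i₀) =
      coverSet T Finset.univ (c - B.card) fun i => a' i + if i ∈ B then 1 else 0 := by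
    ext u
    have hcardB : ∀ A : Finset V, (A ∩ B).card ≤ B.card := fun A =>
      Finset.card_le_card Finset.inter_subset_right
    rw [mem_coverSet_univ_iff_of_bound (p := p (C i₀))]
    · rfl
    · intro A hA hpA
      rw [Finset.sum_add_distrib, hsumB]
      have := hcardB A
      by_cases hex : ∃ b, p b A
      · obtain ⟨b, hb⟩ := hex
        have h1 := hp A hA b hb
        have : (A ∩ B).card < B.card := by
          refine Finset.card_lt_card (Finset.ssubset_iff_of_subset Finset.inter_subset_right |>.2
            ⟨i₀, hi₀B, fun h => ?_⟩)
          have := (hb.2 i₀ hi₀).1 (Finset.mem_inter.1 h).1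
          exact hpA (this ▸ hb)
        omega
      · have := hnp A hA hex
        omega
    · intro A hA hpA
      rw [Finset.sum_add_distrib, hsumB]
      have h1 := hp A hA _ hpA
      have : A ∩ B = B := by
        refine Finset.inter_eq_right.2 fun i hi => ?_
        rw [hB, Finset.mem_filter] at hi
        exact (hpA.2 i hi.1).2 hi.2
      rw [this]
      omega
  have hJ₂ : J (!C i₀) =
      coverSet T Finset.univ c fun i => a' i - if i ∈ B then 1 else 0 := by
    ext u
    rw [mem_coverSet_univ_iff_of_bound (p := p (!C i₀))]
    · rfl
    · intro A hA hpA
      rw [Finset.sum_sub_distrib, hsumB]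
      by_cases hex : ∃ b, p b A
      · obtain ⟨b, hb⟩ := hex
        have h1 := hp A hA b hb
        have hb' : b = C i₀ := by
          by_contra hne
          refine hpA ?_
          rwa [Bool.not_eq.2 (Ne.symm hne)]
        have : 0 < (A ∩ B).card :=
          Finset.card_pos.2 ⟨i₀, Finset.mem_inter.2 ⟨(hb.2 i₀ hi₀).2 hb'.symm, hi₀B⟩⟩
        omega
      · have := hnp A hA hex
        omega
    · intro A hA hpA
      rw [Finset.sum_sub_distrib, hsumB]
      have h1 := hp A hA _ hpA
      have : A ∩ B = ∅ := by
        refine Finset.eq_empty_of_forall_notMem fun i hi => ?_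
        rw [hB, Finset.mem_inter, Finset.mem_filter] at hi
        have := (hpA.2 i hi.2.1).1 hi.1
        rw [hi.2.2] at this
        simp at this
      rw [this]
      simpa using h1
  have hsum_a' : c + ∑ i, (a' i : ℤ) = s + 1 := by rw [hc]; push_cast; ring
  have hD₁ : DepthGE k n (J (C i₀)) := by
    rw [hJ₁]
    refine DepthGE.coverSet hF _ _ _ ?_
    have : ∑ i, max ((a' i : ℤ) + if i ∈ B then 1 else 0) 0 =
        ∑ i, (a' i : ℤ) + B.card := by
      have hcard := hsumB Finset.univ
      rw [Finset.univ_inter] at hcard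
      rw [← hcard, ← Finset.sum_add_distrib]
      refine Finset.sum_congr rfl fun i _ => max_eq_left (add_nonneg (Int.natCast_nonneg _) ?_)
      split_ifs <;> simp
    rw [this, Finset.card_univ]
    omega
  have hD₂ : DepthGE k n (J (!C i₀)) := by
    rw [hJ₂]
    refine DepthGE.coverSet hF _ _ _ ?_
    have : ∑ i, max ((a' i : ℤ) - if i ∈ B then 1 else 0) 0 ≤ ∑ i, (a' i : ℤ) := by
      refine Finset.sum_le_sum fun i _ => ?_
      split_ifs <;> simp
    rw [Finset.card_univ]
    omega
  have hup : ∀ b, IsUpperSet (J b) := fun b u u' h hu A hA hA' =>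
    (hu A hA hA').trans (Finset.sum_le_sum fun i _ => gain_mono h i)
  have hD' : DepthGE k n (J true ∪ J false) := by
    have hDb : ∀ b, DepthGE k n (J b) := fun b => by
      by_cases h : b = C i₀
      · exact h ▸ hD₁
      · exact (Bool.eq_not.2 h) ▸ hD₂
    exact DepthGE.union (hup _) (hup _) (hK ▸ hDK) (hDb _) (hDb _)
  -- the union of the halves is generated by the variables outside `S`
  let S : Finset (V ⊕ V) := M.disjSum (U ∪ M)ᶜ
  have hScard : S.card + (s + 1) = Fintype.card V := by
    have hdisj : Disjoint U M := Finset.disjoint_right.2 fun i hi => (hMU i hi).1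
    have h1 := Finset.card_add_card_compl (U ∪ M)
    rw [Finset.card_union_of_disjoint hdisj, hU] at h1
    rw [Finset.card_disjSum]
    omega
  have hprime : J true ∪ J false = {u | ∃ v ∉ S, u v ≠ 0} := by
    ext u
    rw [show u ∈ J true ∪ J false ↔ ∃ b, u ∈ J b by
      rw [Bool.exists_bool, Set.mem_union, or_comm], Set.mem_ofPred_eq]
    constructor
    · rintro ⟨b, hu⟩
      by_contra! hcon
      have hA : IndepFinset T (U.filter (C · = b) ∪ M) := by
        intro i hi j hj hij
        rw [Finset.mem_union, Finset.mem_filter] at hi hj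
        rcases hi with hi | hi <;> rcases hj with hj | hj
        · exact hC i j hij (hi.2.trans hj.2.symm)
        · exact (hMU j hj).2 i hi.1 hij.symm
        · exact (hMU i hi).2 j hj.1 hij
        · exact hM i hi j hj hij
      have hle := hu _ hA ⟨Finset.subset_union_right, fun i hi => by
        have : i ∉ M := fun h => (hMU i h).1 hi
        simp [hi, this]⟩
      rw [Finset.sum_eq_zero fun i _ => ?_] at hle
      · omega
      · unfold gain
        split_ifs with hi
        · rw [hcon (Sum.inr i) (by simp [S]; grind)]
          simp
        · rw [hcon (Sum.inl i) (by simp [S]; grind)]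
          simp
    · rintro ⟨i | i, hi, h0⟩
      · have hi : i ∉ M := by simpa [S] using hi
        obtain ⟨b, hb⟩ : ∃ b, ∀ A, IndepFinset T A → p b A → i ∉ A := by
          by_cases hiU : i ∈ U
          · exact ⟨!C i, fun A _ hA hiA => by simpa using (hA.2 i hiU).1 hiA⟩
          rcases hdom i hiU hi with ⟨j, hj, hij⟩ | ⟨j, hj, hij⟩
          · exact ⟨C j, fun A hA hpA hiA => hA i hiA j ((hpA.2 j hj).2 rfl) hij⟩
          · exact ⟨true, fun A hA hpA hiA => hA i hiA j (hpA.1 hj) hij⟩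
        exact ⟨b, fun A hA hpA => one_le_sum_gain_inl (hb A hA hpA) h0⟩
      · have hi : i ∈ U ∪ M := by
          by_contra h
          exact hi (by simpa [S] using h)
        refine ⟨C i, fun A hA hpA => one_le_sum_gain_inr ?_ h0⟩
        rcases Finset.mem_union.1 hi with hi | hi
        exacts [(hpA.2 i hi).2 rfl, hpA.1 hi]
  rw [hprime] at hD'
  have hfin := DepthGE.union_variables (k := k) S (n := 1) (P := {u | ∃ v ∉ S, u v ≠ 0})
    (fun u u' h ⟨v, hv, h0⟩ => ⟨v, hv, fun h0' => h0 (Nat.le_zero.1 (h0' ▸ h v))⟩)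
    (fun v hv u ⟨w, hw, h0⟩ => ⟨w, hw, by
      have : v ≠ w := fun h => hw (h ▸ hv)
      simpa [this] using h0⟩)
    (hD'.mono (by omega))
  refine DepthGE.not_one_maximal (σ := V ⊕ V) (k := k) ?_
  convert hfin using 1
  ext u
  simp only [Set.mem_ofPred_eq, Set.mem_union]
  rw [← exists_or, Ne, DFunLike.ext_iff, not_forall]
  refine exists_congr fun v => ?_
  simp only [Finsupp.coe_zero, Pi.zero_apply]
  tauto

end

section

theorem SimpleGraph.IsAcyclic.exists_bool_coloring {V : Type} {T : SimpleGraph V}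
    (hT : T.IsAcyclic) : ∃ C : V → Bool, ∀ i j, T.Adj i j → C i ≠ C j := by
  obtain ⟨C⟩ := hT.colorable_two
  refine ⟨fun i => decide (C i = 0), fun i j hij => ?_⟩
  have := C.valid hij
  rw [Ne, decide_eq_decide]
  omega

variable {k : Type} [Field k]

section

variable {V : Type} {T : SimpleGraph V} [DecidableEq V] [Fintype V]

theorem depthGE_coverSet_univ (hconn : T.Connected) (hacyc : T.IsAcyclic) {n t : ℕ}
    (hn : (n : ℤ) = max ((Fintype.card V : ℤ) - t + 1) 1) :
    DepthGE k n (coverSet T Finset.univ t 0) := by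
  have := hconn.nonempty
  rcases max_choice ((Fintype.card V : ℤ) - t + 1) 1 with h | h
  · refine DepthGE.coverSet hacyc.exists_subsingleton_neighbors _ _ _ ?_
    simp only [Pi.zero_apply, max_self, Finset.sum_const_zero, Finset.card_univ]
    omega
  · obtain rfl : n = 1 := by omega
    exact DepthGE.one_coverSet

theorem not_depthGE_coverSet_univ (hconn : T.Connected) (hacyc : T.IsAcyclic) {n t : ℕ}
    (ht : 1 ≤ t) (hn : (n : ℤ) = max ((Fintype.card V : ℤ) - t + 1) 1) :
    ¬ DepthGE k (n + 1) (coverSet T Finset.univ t 0) := by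
  obtain ⟨C, hC⟩ := hacyc.exists_bool_coloring
  have hne := hconn.nonempty
  have hpos : 0 < Fintype.card V := Fintype.card_pos
  rcases le_total t (Fintype.card V) with hle | hle
  · exact not_depthGE_coverSet_of_le_card hacyc.exists_subsingleton_neighbors hconn C hC ht
      (by omega) (by omega)
  obtain rfl : n = 1 := by omega
  clear hn ht
  induction t, hle using Nat.le_induction with
  | base =>
    exact not_depthGE_coverSet_of_le_card hacyc.exists_subsingleton_neighbors hconn C hC hpos
      (by omega) le_rfl
  | succ t _ ih =>
    intro h
    obtain ⟨i⟩ := hne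
    refine ih ?_
    have := (h.coverSet_colon_inl i 1).coverSet_colon_inr i
    simpa using this

end

theorem monIdeal_le_maxHomIdeal {σ : Type} {P : Set (σ →₀ ℕ)} (hP : (0 : σ →₀ ℕ) ∉ P) :
    monIdeal k P ≤ maxHomIdeal k σ := by
  refine Ideal.span_le.2 ?_
  rintro _ ⟨u, hu, rfl⟩
  have hu0 : u ≠ 0 := fun h => hP (h ▸ hu)
  obtain ⟨v, hv⟩ := Finsupp.ne_iff.1 hu0
  obtain ⟨u', rfl⟩ := exists_add_of_le (Finsupp.single_le_iff.2 (Nat.one_le_iff_ne_zero.2 hv))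
  have : monomial (Finsupp.single v 1 + u') (1 : k) = X v * monomial u' 1 := by
    simp [X, monomial_mul]
  dsimp only
  rw [SetLike.mem_coe, this]
  exact Ideal.mul_mem_right _ _ (Ideal.subset_span ⟨v, rfl⟩)

theorem maxHomIdeal_ne_top {σ : Type} : maxHomIdeal k σ ≠ ⊤ := by
  intro h
  have h1 : (1 : MvPolynomial σ k) ∈ maxHomIdeal k σ := h ▸ Submodule.mem_top
  have h2 : maxHomIdeal k σ ≤ RingHom.ker (constantCoeff (σ := σ) (R := k)) :=
    Ideal.span_le.2 (by rintro _ ⟨v, rfl⟩; simp [RingHom.mem_ker])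
  simpa [RingHom.mem_ker] using h2 h1

theorem Ideal.smul_top_quotient_lt_top {R : Type} [CommRing R] {I m : Ideal R} (hI : I ≤ m)
    (hm : m ≠ ⊤) : m • (⊤ : Submodule R (R ⧸ I)) < ⊤ := by
  refine lt_top_iff_ne_top.2 fun h => hm ?_
  have hle : m • (⊤ : Submodule R (R ⧸ I)) ≤ Submodule.map (Submodule.mkQ I) m := by
    refine Submodule.smul_le.2 fun r hr x _ => ?_
    obtain ⟨s, rfl⟩ := Submodule.mkQ_surjective I x
    exact ⟨r * s, Ideal.mul_mem_right s m hr, rfl⟩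
  obtain ⟨y, hy, hy1⟩ := hle (h.ge (Submodule.mem_top (x := Submodule.mkQ I 1)))
  have h1 : y - 1 ∈ m := hI ((Submodule.Quotient.eq I).1 hy1)
  exact (Ideal.eq_top_iff_one m).2 (by simpa using Ideal.sub_mem m hy h1)

theorem depthQuot_monIdeal {σ : Type} [Finite σ] {n : ℕ} {P : Set (σ →₀ ℕ)}
    (hP : (0 : σ →₀ ℕ) ∉ P) (h : DepthGE k n P) (h' : ¬ DepthGE k (n + 1) P) : depthQuot k (monIdeal k P) = n :=
  ExtVanishing.sInf_localCohomology_eq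
    (Ideal.smul_top_quotient_lt_top (monIdeal_le_maxHomIdeal hP) maxHomIdeal_ne_top) h h'

end

/-- Depth of powers of edge ideals of Cohen-Macaulay trees: if `G` is the whisker graph
of a tree `T` on `d` vertices, then `depth S/I(G)^t = max {d - t + 1, 1}` for all `t ≥ 1`. -/
theorem depth_power_CM_tree (k : Type) [Field k] (d : ℕ) (T : SimpleGraph (Fin d))
    (hconn : T.Connected) (hacyc : T.IsAcyclic) :
    ∀ t : ℕ, 1 ≤ t →
      (depthQuot k ((edgeIdeal k (whiskerGraph T)) ^ t) : ℤ) = max ((d : ℤ) - t + 1) 1 := by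
  intro t ht
  obtain ⟨n, hn⟩ : ∃ n : ℕ, (n : ℤ) = max ((d : ℤ) - t + 1) 1 :=
    ⟨_, Int.toNat_of_nonneg (le_trans zero_le_one (le_max_right _ _))⟩
  have hn' : (n : ℤ) = max ((Fintype.card (Fin d) : ℤ) - t + 1) 1 := by
    rwa [Fintype.card_fin]
  rw [edgeIdeal_whiskerGraph, ← monIdeal_coverSet_eq_pow hacyc.exists_subsingleton_neighbors,
    depthQuot_monIdeal ?_ (depthGE_coverSet_univ hconn hacyc hn')
      (not_depthGE_coverSet_univ hconn hacyc ht hn'), hn]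
  intro h
  have := h ∅ IndepFinset.empty
  simp [gain] at this
  omega
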